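/- arXiv:2311.00788 — 4 statements merged into one kernel-verified Lean document; each statement's English description precedes it below -/
import Mathlib

section
/- There is an absolute constant C > 0 with the following property. Let k ≥ 2 be an integer, let ε ∈ (0,1), and let H be a hypergraph on vertex set {1,…,k} with hyperedges e_1,…,e_m ⊆ {1,…,k}. Then there exists a subset T ⊆ {1,…,m} with |T| ≤ C · k · (log(k/ε))^C / ε², together with nonnegative real weights (w_i)_{i∈T}, such that for every vertex subset S ⊆ {1,…,k}, (1−ε)·|{i ∈ {1,…,m} : e_i crosses S}| ≤ Σ_{i∈T : e_i crosses S} w_i ≤ (1+ε)·|{i ∈ {1,…,m} : e_i crosses S}|. -/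
namespace HCS
open Finset Module

set_option linter.unusedSectionVars false
variable {V : Type*} [AddCommGroup V] [Module (ZMod 2) V] [Fintype V]
variable {ι : Type*} [Fintype ι]

open Classical in
/-- Canonical (slope) filtration. -/
theorem filt (K : ι → Submodule (ZMod 2) V) (n : ℕ) :
    ∀ (W : Submodule (ZMod 2) V) (I : Finset ι) (d : ℝ),
      finrank (ZMod 2) V ≤ finrank (ZMod 2) W + n → 0 < d →
      (∀ i ∈ I, W ≤ K i) → (∀ i ∈ I, K i ≠ ⊤) →
      (∀ U : Submodule (ZMod 2) V, W ≤ U →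
        d * ((finrank (ZMod 2) U : ℝ) - finrank (ZMod 2) W)
          ≤ ((I.filter (fun i => ¬ U ≤ K i)).card : ℝ)) →
      ∃ (D : ι → ℝ) (Θ : Finset ℝ), Θ.card ≤ n ∧ (∀ i ∈ I, D i ∈ Θ ∧ d ≤ D i) ∧
        (∑ i ∈ I, 1 / D i ≤ (finrank (ZMod 2) V : ℝ) - finrank (ZMod 2) W) ∧
        (∀ U : Submodule (ZMod 2) V,
          (finrank (ZMod 2) U : ℝ) - finrank (ZMod 2) (U ⊓ W : Submodule (ZMod 2) V)
            ≤ ∑ i ∈ I.filter (fun i => ¬ U ≤ K i), 1 / D i) ∧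
        ∀ t : ℝ, ∃ W' : Submodule (ZMod 2) V, (∀ i ∈ I, t ≤ D i → W' ≤ K i) ∧
          ∀ U : Submodule (ZMod 2) V,
            (finrank (ZMod 2) U : ℝ) - finrank (ZMod 2) (U ⊓ W' : Submodule (ZMod 2) V)
              ≤ ∑ i ∈ I.filter (fun i => t ≤ D i ∧ ¬ U ≤ K i), 1 / D i := by
  induction n with
  | zero =>
    intro W I d hn hd hW hK hdens
    have hWt : W = ⊤ := Submodule.eq_top_of_finrank_eq
      (le_antisymm (Submodule.finrank_le W) (by simpa using hn))
    have hI : I = ∅ := by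
      apply Finset.eq_empty_of_forall_notMem
      intro i hi
      apply hK i hi
      have := hW i hi
      rw [hWt] at this
      exact top_le_iff.mp this
    subst hI
    subst hWt
    refine ⟨fun _ => 1, ∅, by simp, by simp, by simp, (by intro U; have h : U ⊓ ⊤ = U := inf_top_eq U; rw [h]; simp), ?_⟩
    intro t
    exact ⟨⊤, by simp, (by intro U; have h : U ⊓ ⊤ = U := inf_top_eq U; rw [h]; simp)⟩
  | succ n ih =>
    intro W I d hn hd hW hK hdens
    by_cases hWt : W = ⊤
    · have hI : I = ∅ := by
        apply Finset.eq_empty_of_forall_notMem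
        intro i hi
        apply hK i hi
        have := hW i hi
        rw [hWt] at this
        exact top_le_iff.mp this
      subst hI
      subst hWt
      refine ⟨fun _ => 1, ∅, by simp, by simp, by simp, (by intro U; have h : U ⊓ ⊤ = U := inf_top_eq U; rw [h]; simp), ?_⟩
      intro t
      exact ⟨⊤, by simp, (by intro U; have h : U ⊓ ⊤ = U := inf_top_eq U; rw [h]; simp)⟩
    · obtain ⟨U1, hU1, hmin⟩ := Set.exists_min_image
        {U : Submodule (ZMod 2) V | W < U}
        (fun U => ((I.filter (fun i => ¬ U ≤ K i)).card : ℝ) /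
          ((finrank (ZMod 2) U : ℝ) - finrank (ZMod 2) W)) (Set.toFinite _)
        ⟨⊤, lt_top_iff_ne_top.mpr hWt⟩
      have hU1' : W < U1 := hU1
      have hdimpos : ∀ U : Submodule (ZMod 2) V, W < U →
          (0 : ℝ) < (finrank (ZMod 2) U : ℝ) - finrank (ZMod 2) W := by
        intro U hU
        have := Submodule.finrank_lt_finrank_of_lt hU
        have : (finrank (ZMod 2) W : ℝ) < finrank (ZMod 2) U := by exact_mod_cast this
        linarith
      set s : ℝ := ((I.filter (fun i => ¬ U1 ≤ K i)).card : ℝ) /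
          ((finrank (ZMod 2) U1 : ℝ) - finrank (ZMod 2) W) with hs
      have hI1 : ((I.filter (fun i => ¬ U1 ≤ K i)).card : ℝ) =
          s * ((finrank (ZMod 2) U1 : ℝ) - finrank (ZMod 2) W) := by
        rw [hs, div_mul_cancel₀]
        exact (hdimpos U1 hU1').ne'
      have hds : d ≤ s := by
        rw [hs, le_div_iff₀ (hdimpos U1 hU1')]
        exact hdens U1 hU1'.le
      have hs0 : 0 < s := hd.trans_le hds
      have hsdens : ∀ U : Submodule (ZMod 2) V, W ≤ U →
          s * ((finrank (ZMod 2) U : ℝ) - finrank (ZMod 2) W)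
          ≤ ((I.filter (fun i => ¬ U ≤ K i)).card : ℝ) := by
        intro U hU
        rcases hU.eq_or_lt with rfl | h
        · simp
        · have := hmin U h
          rwa [le_div_iff₀ (hdimpos U h)] at this
      obtain ⟨D2, Θ2, hc2, hD2, hsum2, hbase2, hlev2⟩ := ih U1 (I.filter (fun i => U1 ≤ K i)) s
        (by have := Submodule.finrank_lt_finrank_of_lt hU1'; omega) hs0
        (by intro i hi; exact (Finset.mem_filter.mp hi).2)
        (by intro i hi; exact hK i (Finset.mem_filter.mp hi).1)
        (by
          intro U hU
          have h1 := hsdens U (hU1'.le.trans hU)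
          have h2 : (I.filter (fun i => ¬ U ≤ K i)).card =
              ((I.filter (fun i => U1 ≤ K i)).filter (fun i => ¬ U ≤ K i)).card +
              (I.filter (fun i => ¬ U1 ≤ K i)).card := by
            rw [← Finset.card_filter_add_card_filter_not (s := I.filter (fun i => ¬ U ≤ K i))
              (fun i => U1 ≤ K i)]
            congr 2
            · ext i; simp only [Finset.mem_filter]; tauto
            · ext i; simp only [Finset.mem_filter]
              constructor
              · rintro ⟨⟨a, b⟩, c⟩; exact ⟨a, c⟩
              · rintro ⟨a, c⟩; exact ⟨⟨a, fun h => c (hU.trans h)⟩, c⟩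
          have h2' : ((I.filter (fun i => ¬ U ≤ K i)).card : ℝ) =
              (((I.filter (fun i => U1 ≤ K i)).filter (fun i => ¬ U ≤ K i)).card : ℝ) +
              ((I.filter (fun i => ¬ U1 ≤ K i)).card : ℝ) := by exact_mod_cast h2
          rw [h2', hI1] at h1
          linarith)
      set D : ι → ℝ := fun i => if U1 ≤ K i then D2 i else s with hD
      have hsD : ∀ i ∈ I, s ≤ D i := by
        intro i hi
        simp only [hD]
        split_ifs with h
        · exact (hD2 i (Finset.mem_filter.mpr ⟨hi, h⟩)).2
        · exact le_rfl
      have hsplit : ∀ (P : ι → Prop) [DecidablePred P], ∑ i ∈ I.filter P, 1 / D i =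
          ∑ i ∈ (I.filter (fun i => U1 ≤ K i)).filter P, 1 / D2 i +
          ((I.filter (fun i => ¬ U1 ≤ K i)).filter P).card * (1 / s) := by
        intro P _
        rw [← Finset.sum_filter_add_sum_filter_not (I.filter P) (fun i => U1 ≤ K i)]
        congr 1
        · rw [Finset.filter_comm]
          apply Finset.sum_congr rfl
          intro i hi
          have : U1 ≤ K i := by simp only [Finset.mem_filter] at hi; tauto
          simp [hD, this]
        · rw [Finset.filter_comm, ← nsmul_eq_mul]
          apply Finset.sum_eq_card_nsmul
          intro i hi
          have : ¬ U1 ≤ K i := by simp only [Finset.mem_filter] at hi; tauto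
          simp [hD, this]
      have hbase : ∀ U : Submodule (ZMod 2) V,
          (finrank (ZMod 2) U : ℝ) - finrank (ZMod 2) (U ⊓ W : Submodule (ZMod 2) V)
            ≤ ∑ i ∈ I.filter (fun i => ¬ U ≤ K i), 1 / D i := by
        intro U
        rw [hsplit]
        have h1 := hbase2 U
        have h2 := hsdens ((U ⊓ U1) ⊔ W) le_sup_right
        have h3 := Submodule.finrank_sup_add_finrank_inf_eq (U ⊓ U1) W
        have h4 : (U ⊓ U1) ⊓ W = U ⊓ W := by
          rw [inf_assoc, inf_eq_right.mpr hU1'.le]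
        rw [h4] at h3
        have h3' : (finrank (ZMod 2) ((U ⊓ U1) ⊔ W : Submodule (ZMod 2) V) : ℝ) +
          finrank (ZMod 2) (U ⊓ W : Submodule (ZMod 2) V) =
          finrank (ZMod 2) (U ⊓ U1 : Submodule (ZMod 2) V) + finrank (ZMod 2) W := by
            exact_mod_cast h3
        have h5 : (I.filter (fun i => ¬ (U ⊓ U1) ⊔ W ≤ K i)).card ≤
            ((I.filter (fun i => ¬ U1 ≤ K i)).filter (fun i => ¬ U ≤ K i)).card := by
          apply Finset.card_le_card
          intro i hi
          simp only [Finset.mem_filter] at hi ⊢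
          have hWi := hW i hi.1
          refine ⟨⟨hi.1, fun h => hi.2 ?_⟩, fun h => hi.2 ?_⟩
          · exact sup_le (inf_le_right.trans h) hWi
          · exact sup_le (inf_le_left.trans h) hWi
        have h5' : ((I.filter (fun i => ¬ (U ⊓ U1) ⊔ W ≤ K i)).card : ℝ) ≤
            (((I.filter (fun i => ¬ U1 ≤ K i)).filter (fun i => ¬ U ≤ K i)).card : ℝ) := by
          exact_mod_cast h5
        have h6 : (finrank (ZMod 2) (U ⊓ U1 : Submodule (ZMod 2) V) : ℝ) -
            finrank (ZMod 2) (U ⊓ W : Submodule (ZMod 2) V) ≤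
            (((I.filter (fun i => ¬ U1 ≤ K i)).filter (fun i => ¬ U ≤ K i)).card : ℝ) * (1 / s) := by
          rw [mul_one_div, le_div_iff₀ hs0]
          have : (finrank (ZMod 2) (U ⊓ U1 : Submodule (ZMod 2) V) : ℝ) -
            finrank (ZMod 2) (U ⊓ W : Submodule (ZMod 2) V) =
            (finrank (ZMod 2) ((U ⊓ U1) ⊔ W : Submodule (ZMod 2) V) : ℝ) -
              finrank (ZMod 2) W := by linarith
          rw [this]
          linarith
        linarith
      refine ⟨D, insert s Θ2, (Finset.card_insert_le _ _).trans (by omega), ?_, ?_, hbase, ?_⟩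
      · intro i hi
        refine ⟨?_, hds.trans (hsD i hi)⟩
        simp only [hD]
        split_ifs with h
        · exact Finset.mem_insert_of_mem (hD2 i (Finset.mem_filter.mpr ⟨hi, h⟩)).1
        · exact Finset.mem_insert_self _ _
      · have := hsplit (fun _ => True)
        simp only [Finset.filter_true] at this
        rw [this, hI1]
        have : s * ((finrank (ZMod 2) U1 : ℝ) - finrank (ZMod 2) W) * (1 / s) =
          (finrank (ZMod 2) U1 : ℝ) - finrank (ZMod 2) W := by field_simp
        linarith
      · intro t
        by_cases ht : t ≤ s
        · refine ⟨W, fun i hi _ => hW i hi, ?_⟩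
          intro U
          have : I.filter (fun i => t ≤ D i ∧ ¬ U ≤ K i) = I.filter (fun i => ¬ U ≤ K i) := by
            apply Finset.filter_congr
            intro i hi
            have := ht.trans (hsD i hi)
            tauto
          rw [this]
          exact hbase U
        · obtain ⟨W', hW', hdW'⟩ := hlev2 t
          refine ⟨W', ?_, ?_⟩
          · intro i hi hti
            by_cases h : U1 ≤ K i
            · apply hW' i (Finset.mem_filter.mpr ⟨hi, h⟩)
              simpa [hD, h] using hti
            · simp [hD, h] at hti
              exact absurd hti ht
          · intro U
            refine (hdW' U).trans ?_
            rw [hsplit]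
            have h0 : (0 : ℝ) ≤ ((I.filter (fun i => ¬ U1 ≤ K i)).filter
              (fun i => t ≤ D i ∧ ¬ U ≤ K i)).card * (1 / s) :=
                mul_nonneg (Nat.cast_nonneg _) (one_div_pos.mpr hs0).le
            have : (I.filter (fun i => U1 ≤ K i)).filter (fun i => t ≤ D i ∧ ¬ U ≤ K i) =
              (I.filter (fun i => U1 ≤ K i)).filter (fun i => t ≤ D2 i ∧ ¬ U ≤ K i) := by
              apply Finset.filter_congr
              intro i hi
              simp [hD, (Finset.mem_filter.mp hi).2]
            rw [this]
            linarith

open Classical in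
/-- Counting light vectors by contraction. -/
theorem count_light (K : ι → Submodule (ZMod 2) V) (J : Finset ι) (g : ι → ℝ)
    (hg : ∀ i ∈ J, 0 ≤ g i) (W : Submodule (ZMod 2) V) (hW : ∀ i ∈ J, W ≤ K i)
    (hdens : ∀ U : Submodule (ZMod 2) V,
      (finrank (ZMod 2) U : ℝ) - finrank (ZMod 2) (U ⊓ W : Submodule (ZMod 2) V)
        ≤ ∑ i ∈ J.filter (fun i => ¬ U ≤ K i), g i) (α : ℕ) (r : ℕ) :
    ∀ U : Submodule (ZMod 2) V, W ≤ U →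
      finrank (ZMod 2) U ≤ finrank (ZMod 2) W + r →
      (univ.filter (fun x : V => x ∈ U ∧ ∑ i ∈ J.filter (fun i => x ∉ K i), g i ≤ α)).card
        ≤ 2 ^ finrank (ZMod 2) W * ((max r α).choose α * 2 ^ α) := by
  induction r with
  | zero =>
    intro U hWU hU
    have h1 : (univ.filter (fun x : V => x ∈ U ∧
        ∑ i ∈ J.filter (fun i => x ∉ K i), g i ≤ α)).card ≤ 2 ^ finrank (ZMod 2) U := by
      have := Module.card_eq_pow_finrank (K := ZMod 2) (V := U)
      rw [ZMod.card] at this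
      rw [← this, Fintype.card_subtype]
      apply Finset.card_le_card
      intro x hx
      simp only [Finset.mem_filter] at hx ⊢
      tauto
    refine h1.trans ((Nat.pow_le_pow_right (by norm_num) hU).trans ?_)
    simp only [add_zero, zero_le, sup_of_le_right, Nat.choose_self, one_mul]
    exact Nat.le_mul_of_pos_right _ (by positivity)
  | succ r ih =>
    intro U hWU hU
    by_cases hlt : finrank (ZMod 2) U ≤ finrank (ZMod 2) W + r
    · refine (ih U hWU hlt).trans ?_
      gcongr
      omega
    have hUe : finrank (ZMod 2) U = finrank (ZMod 2) W + (r + 1) := by omega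
    by_cases hra : r + 1 ≤ α
    · have h1 : (univ.filter (fun x : V => x ∈ U ∧
          ∑ i ∈ J.filter (fun i => x ∉ K i), g i ≤ α)).card ≤ 2 ^ finrank (ZMod 2) U := by
        have := Module.card_eq_pow_finrank (K := ZMod 2) (V := U)
        rw [ZMod.card] at this
        rw [← this, Fintype.card_subtype]
        apply Finset.card_le_card
        intro x hx
        simp only [Finset.mem_filter] at hx ⊢
        tauto
      refine h1.trans ?_
      rw [hUe, pow_add, max_eq_right hra, Nat.choose_self, one_mul]
      gcongr
      norm_num
    push Not at hra
    set S := J.filter (fun i => ¬ U ≤ K i) with hS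
    set Λ := univ.filter (fun x : V => x ∈ U ∧ ∑ i ∈ J.filter (fun i => x ∉ K i), g i ≤ α) with hΛ
    set B : ℕ := 2 ^ finrank (ZMod 2) W * ((max r α).choose α * 2 ^ α) with hB
    have hs : ((r : ℝ) + 1) ≤ ∑ i ∈ S, g i := by
      have := hdens U
      rw [inf_eq_right.mpr hWU, hUe] at this
      push_cast at this
      linarith
    have hgS : ∀ i ∈ S, 0 ≤ g i := fun i hi => hg i (Finset.mem_filter.mp hi).1
    -- upper bound
    have hup : ∑ i ∈ S, ∑ x ∈ Λ, (if x ∈ K i then g i else 0) ≤ (∑ i ∈ S, g i) * B := by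
      rw [Finset.sum_mul]
      apply Finset.sum_le_sum
      intro i hi
      have hiS := Finset.mem_filter.mp hi
      rw [← Finset.sum_filter, Finset.sum_const, nsmul_eq_mul, mul_comm]
      apply mul_le_mul_of_nonneg_left _ (hgS i hi)
      have hlt2 : U ⊓ K i < U := inf_lt_left.mpr hiS.2
      have := ih (U ⊓ K i) (le_inf hWU (hW i hiS.1))
        (by have := Submodule.finrank_lt_finrank_of_lt hlt2; omega)
      have h2 : Λ.filter (fun x => x ∈ K i) = univ.filter (fun x : V => x ∈ U ⊓ K i ∧
          ∑ i ∈ J.filter (fun i => x ∉ K i), g i ≤ α) := by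
        ext x
        simp only [hΛ, Finset.mem_filter, Submodule.mem_inf]
        tauto
      rw [h2]
      exact_mod_cast this
    have hlow : (Λ.card : ℝ) * ((∑ i ∈ S, g i) - α) ≤
        ∑ i ∈ S, ∑ x ∈ Λ, (if x ∈ K i then g i else 0) := by
      rw [Finset.sum_comm, ← nsmul_eq_mul]
      apply Finset.card_nsmul_le_sum
      intro x hx
      have hx' := (Finset.mem_filter.mp hx).2
      rw [← Finset.sum_filter]
      have h1 := Finset.sum_filter_add_sum_filter_not S (fun i => x ∈ K i) g
      have h2 : S.filter (fun i => ¬ x ∈ K i) = J.filter (fun i => x ∉ K i) := by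
        ext i
        simp only [hS, Finset.mem_filter]
        constructor
        · tauto
        · rintro ⟨a, b⟩
          exact ⟨⟨a, fun h => b (h hx'.1)⟩, b⟩
      rw [h2] at h1
      linarith [hx'.2]
    have hmain : (Λ.card : ℝ) * ((∑ i ∈ S, g i) - α) ≤ (∑ i ∈ S, g i) * B := hlow.trans hup
    have hmain2 : (Λ.card : ℝ) * ((r + 1 : ℝ) - α) ≤ (r + 1) * B := by
      have hα : (α : ℝ) < r + 1 := by exact_mod_cast hra
      by_cases hc : (Λ.card : ℝ) ≤ B
      · have : (Λ.card : ℝ) * ((r + 1 : ℝ) - α) ≤ Λ.card * (r + 1) := by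
          apply mul_le_mul_of_nonneg_left _ (by positivity)
          have : (0:ℝ) ≤ α := by positivity
          linarith
        nlinarith
      · push Not at hc
        nlinarith [mul_le_mul_of_nonneg_left hs (sub_nonneg.mpr hc.le)]
    have hrα : α ≤ r := by omega
    have hch := Nat.choose_mul_succ_eq r α
    have hch' : (r.choose α : ℝ) * (r + 1) = ((r + 1).choose α : ℝ) * ((r + 1 : ℝ) - α) := by
      have : ((r + 1 - α : ℕ) : ℝ) = (r : ℝ) + 1 - α := by
        rw [Nat.cast_sub (by omega)]; push_cast; ring
      rw [← this]
      exact_mod_cast hch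
    have hpos : (0 : ℝ) < (r + 1 : ℝ) - α := by
      have : (α : ℝ) < r + 1 := by exact_mod_cast hra
      linarith
    have hfin : (Λ.card : ℝ) ≤ 2 ^ finrank (ZMod 2) W * (((r + 1).choose α : ℝ) * 2 ^ α) := by
      rw [← mul_le_mul_iff_left₀ hpos]
      refine hmain2.trans (le_of_eq ?_)
      rw [hB, max_eq_left hrα]
      push_cast
      linear_combination (2 ^ finrank (ZMod 2) W * 2 ^ α : ℝ) * hch'
    rw [max_eq_left (by omega : α ≤ r + 1)]
    exact_mod_cast hfin

/-- Summation by parts over thresholds. -/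
theorem abel (D : ι → ℝ) (a : ι → ℝ) (n : ℕ) : ∀ (s : Finset ι), s.card ≤ n →
    ∀ t0 : ℝ, (∀ i ∈ s, t0 ≤ D i) →
    (∀ j ∈ s, 0 ≤ ∑ i ∈ s.filter (fun i => D j ≤ D i), a i) →
    0 ≤ ∑ i ∈ s, (D i - t0) * a i := by
  induction n with
  | zero =>
    intro s hs t0 _ _
    have : s = ∅ := by simpa using hs
    simp [this]
  | succ n ih =>
    intro s hs t0 ht0 hsum
    rcases s.eq_empty_or_nonempty with rfl | hne
    · simp
    obtain ⟨j, hj, hmin⟩ := Finset.exists_min_image s D hne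
    have h1 : s.filter (fun i => D j ≤ D i) = s := by
      apply Finset.filter_true_of_mem hmin
    have h2 := hsum j hj
    rw [h1] at h2
    have h3 := ih (s.filter (fun i => D j < D i)) (by
        have : (s.filter (fun i => D j < D i)).card < s.card := by
          apply Finset.card_lt_card
          rw [Finset.filter_ssubset]
          exact ⟨j, hj, lt_irrefl _⟩
        omega) (D j) (by intro i hi; exact (Finset.mem_filter.mp hi).2.le) (by
        intro l hl
        have hl' := Finset.mem_filter.mp hl
        have := hsum l hl'.1
        rw [Finset.filter_filter]
        convert this using 2
        ext i
        simp only [Finset.mem_filter]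
        constructor
        · tauto
        · rintro ⟨a, b⟩; exact ⟨a, hl'.2.trans_le b, b⟩)
    have h4 : ∑ i ∈ s.filter (fun i => D j < D i), (D i - D j) * a i =
        ∑ i ∈ s, (D i - D j) * a i := by
      apply Finset.sum_filter_of_ne
      intro i hi hne
      rcases (hmin i hi).eq_or_lt with h | h
      · exact absurd (by rw [h]; ring) hne
      · exact h
    rw [h4] at h3
    have h5 : ∑ i ∈ s, (D i - t0) * a i = ∑ i ∈ s, (D i - D j) * a i + (D j - t0) * ∑ i ∈ s, a i := by
      rw [Finset.mul_sum, ← Finset.sum_add_distrib]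
      apply Finset.sum_congr rfl
      intro i _
      ring
    rw [h5]
    have := mul_nonneg (sub_nonneg.mpr (ht0 j hj)) h2
    linarith

section avg
variable [DecidableEq ι]

/-- Weight of a subset in the product distribution. -/
noncomputable def wt (p : ι → ℝ) (T : Finset ι) : ℝ := ∏ i, if i ∈ T then p i else 1 - p i

theorem wt_prod (p a b : ι → ℝ) :
    ∑ T : Finset ι, wt p T * (∏ i, if i ∈ T then a i else b i) =
      ∏ i, (p i * a i + (1 - p i) * b i) := by
  rw [Finset.prod_add, Finset.powerset_univ]
  apply Finset.sum_congr rfl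
  intro T _
  rw [wt, ← Finset.prod_mul_distrib]
  rw [← Finset.prod_sdiff (Finset.subset_univ T), mul_comm]
  congr 1
  · apply Finset.prod_congr rfl
    intro i hi
    simp [hi]
  · apply Finset.prod_congr rfl
    intro i hi
    have : i ∉ T := (Finset.mem_sdiff.mp hi).2
    simp [this]

theorem wt_exists (p : ι → ℝ) (hp0 : ∀ i, 0 ≤ p i) (hp1 : ∀ i, p i ≤ 1) (f : Finset ι → ℝ)
    (c : ℝ) (h : ∑ T : Finset ι, wt p T * f T < c) :
    ∃ T : Finset ι, f T < c ∧ (∀ i, p i = 1 → i ∈ T) ∧ (∀ i, p i = 0 → i ∉ T) := by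
  have hwt0 : ∀ T, 0 ≤ wt p T := by
    intro T
    apply Finset.prod_nonneg
    intro i _
    split_ifs
    · exact hp0 i
    · linarith [hp1 i]
  have hwt1 : ∑ T : Finset ι, wt p T = 1 := by
    have := wt_prod p (fun _ => 1) (fun _ => 1)
    simpa using this
  have : ∃ T, 0 < wt p T ∧ f T < c := by
    by_contra hcon
    push Not at hcon
    have : ∑ T : Finset ι, wt p T * c ≤ ∑ T : Finset ι, wt p T * f T := by
      apply Finset.sum_le_sum
      intro T _
      rcases (hwt0 T).eq_or_lt with h0 | h0
      · simp [← h0]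
      · exact mul_le_mul_of_nonneg_left (hcon T h0) h0.le
    rw [← Finset.sum_mul, hwt1] at this
    linarith
  obtain ⟨T, hT, hf⟩ := this
  refine ⟨T, hf, ?_, ?_⟩
  · intro i hi
    by_contra hn
    have : wt p T = 0 := Finset.prod_eq_zero (Finset.mem_univ i) (by simp [hn, hi])
    linarith
  · intro i hi hn
    have : wt p T = 0 := Finset.prod_eq_zero (Finset.mem_univ i) (by simp [hn, hi])
    linarith
end avg

theorem mgf (p l : ℝ) (hp : 0 ≤ p) (hl : |l| ≤ 1) :
    p * Real.exp (l * (1 - p)) + (1 - p) * Real.exp (l * (0 - p)) ≤ Real.exp (l ^ 2 * p) := by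
  have h1 : p * Real.exp (l * (1 - p)) + (1 - p) * Real.exp (l * (0 - p)) =
      (1 + p * (Real.exp l - 1)) * Real.exp (-(l * p)) := by
    have : Real.exp (l * (1 - p)) = Real.exp l * Real.exp (-(l * p)) := by
      rw [← Real.exp_add]; ring_nf
    rw [this]
    have : l * (0 - p) = -(l * p) := by ring
    rw [this]; ring
  have h2 := Real.abs_exp_sub_one_sub_id_le hl
  have h3 := (abs_le.mp h2).2
  have h4 : 1 + p * (Real.exp l - 1) ≤ Real.exp (p * (l + l ^ 2)) := by
    have h5 := Real.add_one_le_exp (p * (Real.exp l - 1))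
    have h6 : Real.exp (p * (Real.exp l - 1)) ≤ Real.exp (p * (l + l ^ 2)) := by
      apply Real.exp_le_exp.mpr
      apply mul_le_mul_of_nonneg_left _ hp
      linarith
    linarith
  rw [h1]
  calc _ ≤ Real.exp (p * (l + l ^ 2)) * Real.exp (-(l * p)) := by gcongr
    _ = _ := by rw [← Real.exp_add]; ring_nf
open Classical in
/-- Total failure weight at one level of the filtration. -/
theorem Zbound (K : ι → Submodule (ZMod 2) V) (J : Finset ι) (g : ι → ℝ)
    (hg : ∀ i ∈ J, 0 ≤ g i) (W : Submodule (ZMod 2) V) (hW : ∀ i ∈ J, W ≤ K i)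
    (hdens : ∀ U : Submodule (ZMod 2) V,
      (finrank (ZMod 2) U : ℝ) - finrank (ZMod 2) (U ⊓ W : Submodule (ZMod 2) V)
        ≤ ∑ i ∈ J.filter (fun i => ¬ U ≤ K i), g i) (k : ℕ) (hk : 2 ≤ k)
    (hV : finrank (ZMod 2) V ≤ k) :
    ∑ x ∈ univ.filter (fun x : V => x ∉ W),
      Real.exp (-(8 * Real.log k * ∑ i ∈ J.filter (fun i => x ∉ K i), g i))
      ≤ 2 ^ finrank (ZMod 2) W * (2 / (k : ℝ) ^ 4) := by
  have hk' : (2 : ℝ) ≤ k := by exact_mod_cast hk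
  have hk0 : (0 : ℝ) < k := by linarith
  set G : V → ℝ := fun x => ∑ i ∈ J.filter (fun i => x ∉ K i), g i with hG
  have hG1 : ∀ x ∉ W, 1 ≤ G x := by
    intro x hx
    have h1 := hdens (Submodule.span (ZMod 2) {x})
    have hlt : Submodule.span (ZMod 2) {x} ⊓ W < Submodule.span (ZMod 2) {x} := by
      rw [inf_lt_left, Submodule.span_singleton_le_iff_mem]
      exact hx
    have h2 := Submodule.finrank_lt_finrank_of_lt hlt
    have h3 : (finrank (ZMod 2) (Submodule.span (ZMod 2) {x} ⊓ W : Submodule (ZMod 2) V) : ℝ) + 1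
      ≤ finrank (ZMod 2) (Submodule.span (ZMod 2) {x}) := by exact_mod_cast h2
    simp only [Submodule.span_singleton_le_iff_mem] at h1
    simp only [hG]
    linarith
  have hGle : ∀ x, G x ≤ ∑ i ∈ J, g i := by
    intro x
    apply Finset.sum_le_sum_of_subset_of_nonneg (Finset.filter_subset _ _)
    intro i hi _
    exact hg i hi
  set N : ℕ := ⌊∑ i ∈ J, g i⌋₊ + 1 with hN
  have hmaps : ∀ x ∈ univ.filter (fun x : V => x ∉ W), ⌊G x⌋₊ - 1 ∈ Finset.range N := by
    intro x _
    have := Nat.floor_le_floor (hGle x)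
    rw [Finset.mem_range]
    omega
  rw [← Finset.sum_fiberwise_of_maps_to hmaps]
  set y : ℝ := 1 / (k : ℝ) ^ 4 with hy
  have hy0 : 0 ≤ y := by positivity
  have hy1 : y ≤ 1 / 2 := by
    rw [hy]
    apply one_div_le_one_div_of_le (by norm_num)
    calc (2 : ℝ) ≤ 2 ^ 4 := by norm_num
      _ ≤ (k : ℝ) ^ 4 := by gcongr
  have hclass : ∀ b ∈ Finset.range N,
      ∑ x ∈ (univ.filter (fun x : V => x ∉ W)).filter (fun x => ⌊G x⌋₊ - 1 = b),
        Real.exp (-(8 * Real.log k * G x)) ≤ 2 ^ finrank (ZMod 2) W * (y * y ^ b) := by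
    intro b _
    have hlog : 0 ≤ Real.log k := Real.log_nonneg (by linarith)
    have hb : ∀ x ∈ (univ.filter (fun x : V => x ∉ W)).filter (fun x => ⌊G x⌋₊ - 1 = b),
        (b : ℝ) + 1 ≤ G x ∧ G x ≤ ((b + 2 : ℕ) : ℝ) := by
      intro x hx
      simp only [Finset.mem_filter] at hx
      have h1 := hG1 x hx.1.2
      have h2 : 1 ≤ ⌊G x⌋₊ := Nat.le_floor (by simpa using h1)
      have h3 : ⌊G x⌋₊ = b + 1 := by omega
      have h4 := Nat.floor_le (by linarith : 0 ≤ G x)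
      have h5 := Nat.lt_floor_add_one (G x)
      rw [h3] at h4 h5
      push_cast at h4 h5 ⊢
      constructor <;> linarith
    have hexp : ∀ x ∈ (univ.filter (fun x : V => x ∉ W)).filter (fun x => ⌊G x⌋₊ - 1 = b),
        Real.exp (-(8 * Real.log k * G x)) ≤ ((k : ℝ) ^ (8 * (b + 1)))⁻¹ := by
      intro x hx
      have h1 := (hb x hx).1
      have : Real.exp (8 * Real.log k * ((b : ℝ) + 1)) = (k : ℝ) ^ (8 * (b + 1)) := by
        rw [show 8 * Real.log k * ((b : ℝ) + 1) = ((8 * (b + 1) : ℕ) : ℝ) * Real.log k by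
          push_cast; ring, Real.exp_nat_mul, Real.exp_log hk0]
      rw [← this, ← Real.exp_neg]
      apply Real.exp_le_exp.mpr
      apply neg_le_neg
      apply mul_le_mul_of_nonneg_left h1
      positivity
    have hcard : (((univ.filter (fun x : V => x ∉ W)).filter (fun x => ⌊G x⌋₊ - 1 = b)).card : ℝ)
        ≤ 2 ^ finrank (ZMod 2) W * (k : ℝ) ^ (4 * (b + 1)) := by
      have h1 := count_light K J g hg W hW hdens (b + 2) k ⊤ le_top
        (by rw [finrank_top]; omega)
      have h2 : ((univ.filter (fun x : V => x ∉ W)).filter (fun x => ⌊G x⌋₊ - 1 = b)).card ≤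
          (univ.filter (fun x : V => x ∈ (⊤ : Submodule (ZMod 2) V) ∧
            ∑ i ∈ J.filter (fun i => x ∉ K i), g i ≤ ((b + 2 : ℕ) : ℝ))).card := by
        apply Finset.card_le_card
        intro x hx
        simp only [Finset.mem_filter, Finset.mem_univ, true_and, Submodule.mem_top]
        exact (hb x hx).2
      have h3 : (max k (b + 2)).choose (b + 2) ≤ k ^ (b + 2) := by
        rcases le_total k (b + 2) with h | h
        · rw [max_eq_right h, Nat.choose_self]
          exact Nat.one_le_pow _ _ (by omega)
        · rw [max_eq_left h]
          exact Nat.choose_le_pow _ _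
      have h4 : 2 ^ finrank (ZMod 2) W * ((max k (b + 2)).choose (b + 2) * 2 ^ (b + 2)) ≤
          2 ^ finrank (ZMod 2) W * k ^ (4 * (b + 1)) := by
        apply Nat.mul_le_mul_left
        calc (max k (b + 2)).choose (b + 2) * 2 ^ (b + 2) ≤ k ^ (b + 2) * k ^ (b + 2) := by
              gcongr
          _ = k ^ (2 * (b + 2)) := by rw [← pow_add]; ring_nf
          _ ≤ k ^ (4 * (b + 1)) := Nat.pow_le_pow_right (by omega) (by omega)
      have := (h2.trans h1).trans h4
      exact_mod_cast this
    calc _ ≤ (((univ.filter (fun x : V => x ∉ W)).filter (fun x => ⌊G x⌋₊ - 1 = b)).card : ℝ) *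
          ((k : ℝ) ^ (8 * (b + 1)))⁻¹ := by
          rw [← nsmul_eq_mul]
          exact Finset.sum_le_card_nsmul _ _ _ hexp
      _ ≤ 2 ^ finrank (ZMod 2) W * (k : ℝ) ^ (4 * (b + 1)) * ((k : ℝ) ^ (8 * (b + 1)))⁻¹ := by
          gcongr
      _ = 2 ^ finrank (ZMod 2) W * (y * y ^ b) := by
          rw [← pow_succ', hy, div_pow, one_pow, ← pow_mul,
            show 8 * (b + 1) = 4 * (b + 1) + 4 * (b + 1) by ring, pow_add]
          field_simp
  refine (Finset.sum_le_sum hclass).trans ?_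
  rw [← Finset.mul_sum, ← Finset.mul_sum]
  apply mul_le_mul_of_nonneg_left _ (by positivity)
  have hgeom : ∑ b ∈ Finset.range N, y ^ b ≤ 2 := by
    have hs := summable_geometric_of_lt_one hy0 (by linarith : y < 1)
    have h1 := hs.sum_le_tsum (Finset.range N) (fun b _ => by positivity)
    rw [tsum_geometric_of_lt_one hy0 (by linarith)] at h1
    refine h1.trans ?_
    rw [inv_le_comm₀ (by linarith) (by norm_num)]
    linarith
  calc y * ∑ b ∈ Finset.range N, y ^ b ≤ y * 2 := by gcongr
    _ = 2 / (k : ℝ) ^ 4 := by rw [hy]; ring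

open Classical in
/-- Expectation of one exponential term. -/
theorem term_bound (p : ι → ℝ) (hp0 : ∀ i, 0 ≤ p i) (hp1 : ∀ i, p i ≤ 1)
    (A : Finset ι) (l c : ℝ) (hl : |l| ≤ 1) :
    ∑ T : Finset ι, wt p T *
      Real.exp (l * ∑ i ∈ A, ((if i ∈ T then 1 else 0) - p i) - c)
      ≤ Real.exp (l ^ 2 * ∑ i ∈ A, p i - c) := by
  have h1 : ∀ T : Finset ι,
      Real.exp (l * ∑ i ∈ A, ((if i ∈ T then 1 else 0) - p i) - c) =
      Real.exp (-c) * ∏ i, (if i ∈ T then (if i ∈ A then Real.exp (l * (1 - p i)) else 1)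
        else (if i ∈ A then Real.exp (l * (0 - p i)) else 1)) := by
    intro T
    rw [sub_eq_add_neg, Real.exp_add, mul_comm, Finset.mul_sum, Real.exp_sum]
    congr 1
    rw [← Finset.prod_subset (Finset.subset_univ A)]
    · apply Finset.prod_congr rfl
      intro i hi
      by_cases hT : i ∈ T <;> simp [hT, hi]
    · intro i _ hi
      simp [hi]
  have h2 : ∑ T : Finset ι, wt p T *
      Real.exp (l * ∑ i ∈ A, ((if i ∈ T then 1 else 0) - p i) - c) =
      Real.exp (-c) * ∏ i, (p i * (if i ∈ A then Real.exp (l * (1 - p i)) else 1)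
        + (1 - p i) * (if i ∈ A then Real.exp (l * (0 - p i)) else 1)) := by
    rw [← wt_prod, Finset.mul_sum]
    apply Finset.sum_congr rfl
    intro T _
    rw [h1]; ring
  have h3 : ∏ i, (p i * (if i ∈ A then Real.exp (l * (1 - p i)) else 1)
        + (1 - p i) * (if i ∈ A then Real.exp (l * (0 - p i)) else 1)) =
      ∏ i ∈ A, (p i * Real.exp (l * (1 - p i)) + (1 - p i) * Real.exp (l * (0 - p i))) := by
    rw [← Finset.prod_subset (Finset.subset_univ A)]
    · apply Finset.prod_congr rfl
      intro i hi
      simp [hi]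
    · intro i _ hi
      simp [hi]
  have h4 : ∏ i ∈ A, (p i * Real.exp (l * (1 - p i)) + (1 - p i) * Real.exp (l * (0 - p i)))
      ≤ ∏ i ∈ A, Real.exp (l ^ 2 * p i) := by
    apply Finset.prod_le_prod
    · intro i _
      have := hp0 i
      have := sub_nonneg.mpr (hp1 i)
      positivity
    · intro i _
      exact mgf (p i) l (hp0 i) hl
  rw [h2, h3, sub_eq_add_neg, Real.exp_add, Finset.mul_sum, Real.exp_sum, mul_comm]
  gcongr

open Classical in
theorem core (K : ι → Submodule (ZMod 2) V) (k : ℕ) (hk : 8 ≤ k)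
    (hV : finrank (ZMod 2) V ≤ k) (ε : ℝ) (hε0 : 0 < ε) (hε1 : ε < 1) :
    ∃ (T : Finset ι) (w : ι → ℝ), (∀ i, 0 ≤ w i) ∧
      (T.card : ℝ) ≤ 1 + 32 * Real.log k / ε ^ 2 * k / Real.log 2 ∧
      ∀ x : V, (1 - ε) * ((univ.filter (fun i => x ∉ K i)).card : ℝ)
          ≤ ∑ i ∈ T.filter (fun i => x ∉ K i), w i ∧
        ∑ i ∈ T.filter (fun i => x ∉ K i), w i ≤
          (1 + ε) * ((univ.filter (fun i => x ∉ K i)).card : ℝ) := by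
  set I : Finset ι := univ.filter (fun i => K i ≠ ⊤) with hI
  set W0 : Submodule (ZMod 2) V := ⨅ i ∈ I, K i with hW0
  have hk' : (8 : ℝ) ≤ k := by exact_mod_cast hk
  have hk0 : (0 : ℝ) < k := by linarith
  obtain ⟨D, Θ, hΘ, hDΘ, hsum, -, hlev⟩ := filt K k W0 I (1 / (k : ℝ)) (by omega) (by positivity)
    (fun i hi => iInf₂_le i hi) (fun i hi => (Finset.mem_filter.mp hi).2) (by
      intro U hU
      rcases hU.eq_or_lt with rfl | hlt
      · simp
      · have h1 : 1 ≤ (I.filter (fun i => ¬ U ≤ K i)).card := by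
          rw [Nat.one_le_iff_ne_zero, Finset.card_ne_zero]
          by_contra hne
          rw [Finset.not_nonempty_iff_eq_empty, Finset.filter_eq_empty_iff] at hne
          apply hlt.not_ge
          apply le_iInf₂
          intro i hi
          exact not_not.mp (hne hi)
        have h1' : (1 : ℝ) ≤ ((I.filter (fun i => ¬ U ≤ K i)).card : ℝ) := by exact_mod_cast h1
        refine le_trans ?_ h1'
        rw [one_div, inv_mul_le_iff₀ hk0, mul_one]
        have h2 : (finrank (ZMod 2) U : ℝ) ≤ k := by
          exact_mod_cast (Submodule.finrank_le U).trans hV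
        have h3 : (0 : ℝ) ≤ finrank (ZMod 2) W0 := by positivity
        linarith)
  have hD0 : ∀ i ∈ I, 0 < D i := fun i hi =>
    lt_of_lt_of_le (by positivity : (0:ℝ) < 1 / k) (hDΘ i hi).2
  choose Wt hWt hdWt using hlev
  have hlogk : 0 < Real.log k := Real.log_pos (by linarith)
  set ρ : ℝ := 32 * Real.log k / ε ^ 2 with hρ
  have hρ0 : 0 < ρ := by positivity
  set p : ι → ℝ := fun i => if i ∈ I then min 1 (ρ / D i) else 0 with hp
  have hp0 : ∀ i, 0 ≤ p i := by
    intro i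
    simp only [hp]
    split_ifs with h
    · have := hD0 i h
      positivity
    · exact le_rfl
  have hp1 : ∀ i, p i ≤ 1 := by
    intro i
    simp only [hp]
    split_ifs with h
    · exact min_le_left _ _
    · exact zero_le_one
  have hpD : ∀ i ∈ I, p i ≤ ρ * (1 / D i) := by
    intro i hi
    simp only [hp, hi, if_true]
    rw [mul_one_div]
    exact min_le_right _ _
  set J : ℝ → Finset ι := fun t => I.filter (fun i => t ≤ D i) with hJ
  set G : ℝ → V → ℝ := fun t x => ∑ i ∈ (J t).filter (fun i => x ∉ K i), 1 / D i with hG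
  set A : ℝ → V → Finset ι := fun t x => ((J t).filter (fun i => x ∉ K i)).filter
    (fun i => ρ < D i) with hA
  have hJI : ∀ t, ∀ i ∈ J t, i ∈ I := fun t i hi => (Finset.mem_filter.mp hi).1
  have hAp : ∀ t x, ∑ i ∈ A t x, p i ≤ ρ * G t x := by
    intro t x
    simp only [hG]
    rw [Finset.mul_sum]
    calc ∑ i ∈ A t x, p i ≤ ∑ i ∈ (J t).filter (fun i => x ∉ K i), p i :=
          Finset.sum_le_sum_of_subset_of_nonneg (Finset.filter_subset _ _) (fun i _ _ => hp0 i)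
      _ ≤ _ := Finset.sum_le_sum (fun i hi => hpD i (hJI t i (Finset.mem_filter.mp hi).1))
  -- the potential
  set E : ℝ → V → ℝ → Finset ι → ℝ := fun t x l T =>
    Real.exp (l * ∑ i ∈ A t x, ((if i ∈ T then 1 else 0) - p i) - ε ^ 2 / 2 * ρ * G t x) with hE
  have hEbound : ∀ t x l, |l| = ε / 2 → ∑ T : Finset ι, wt p T * E t x l T ≤
      Real.exp (-(8 * Real.log k * G t x)) := by
    intro t x l hl
    refine (term_bound p hp0 hp1 (A t x) l _ (by linarith)).trans ?_
    apply Real.exp_le_exp.mpr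
    have h1 : l ^ 2 = ε ^ 2 / 4 := by rw [← sq_abs, hl]; ring
    have h2 : ε ^ 2 / 4 * ρ = 8 * Real.log k := by rw [hρ]; field_simp; norm_num
    have h3 := mul_le_mul_of_nonneg_left (hAp t x) (by positivity : 0 ≤ ε ^ 2 / 4)
    rw [h1]
    have h4 : 8 * Real.log k * G t x = ε ^ 2 / 4 * (ρ * G t x) := by rw [← h2]; ring
    rw [h4]
    linarith
  set F : Finset ι → ℝ := fun T => Real.exp (-(ρ * k)) / 2 * (∏ i : ι, if i ∈ T then 2 else 1) +
    ∑ t ∈ Θ, ∑ x ∈ univ.filter (fun x : V => x ∉ Wt t),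
      (E t x (ε / 2) T + E t x (-(ε / 2)) T) / 2 ^ finrank (ZMod 2) (Wt t) with hF
  have hcount : ∑ T : Finset ι, wt p T *
      (Real.exp (-(ρ * k)) / 2 * (∏ i : ι, if i ∈ T then (2 : ℝ) else 1)) ≤ 1 / 2 := by
    have h1 : ∑ T : Finset ι, wt p T *
      (Real.exp (-(ρ * k)) / 2 * (∏ i : ι, if i ∈ T then (2 : ℝ) else 1)) =
      Real.exp (-(ρ * k)) / 2 * ∏ i, (p i * 2 + (1 - p i) * 1) := by
      rw [← wt_prod p (fun _ => 2) (fun _ => 1), Finset.mul_sum]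
      apply Finset.sum_congr rfl
      intro T _
      ring
    have h2 : ∏ i, (p i * 2 + (1 - p i) * 1) ≤ Real.exp (ρ * k) := by
      calc ∏ i, (p i * 2 + (1 - p i) * 1) ≤ ∏ i, Real.exp (p i) := by
            apply Finset.prod_le_prod
            · intro i _; linarith [hp0 i]
            · intro i _; linarith [Real.add_one_le_exp (p i)]
        _ = Real.exp (∑ i, p i) := by rw [Real.exp_sum]
        _ ≤ _ := by
          apply Real.exp_le_exp.mpr
          have h3 : ∑ i, p i = ∑ i ∈ I, p i := by
            symm
            apply Finset.sum_subset (Finset.subset_univ I)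
            intro i _ hi
            simp [hp, hi]
          rw [h3]
          calc ∑ i ∈ I, p i ≤ ∑ i ∈ I, ρ * (1 / D i) := Finset.sum_le_sum hpD
            _ = ρ * ∑ i ∈ I, 1 / D i := by rw [Finset.mul_sum]
            _ ≤ ρ * k := by
              apply mul_le_mul_of_nonneg_left _ hρ0.le
              have h4 : (finrank (ZMod 2) V : ℝ) ≤ k := by exact_mod_cast hV
              have h5 : (0 : ℝ) ≤ finrank (ZMod 2) W0 := by positivity
              linarith
    rw [h1]
    calc _ ≤ Real.exp (-(ρ * k)) / 2 * Real.exp (ρ * k) := by gcongr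
      _ = 1 / 2 := by rw [Real.exp_neg]; field_simp
  have hlevel : ∀ t ∈ Θ, ∑ x ∈ univ.filter (fun x : V => x ∉ Wt t), ∑ T : Finset ι, wt p T *
      ((E t x (ε / 2) T + E t x (-(ε / 2)) T) / 2 ^ finrank (ZMod 2) (Wt t)) ≤
      4 / (k : ℝ) ^ 4 := by
    intro t _
    have h2 : (0 : ℝ) < 2 ^ finrank (ZMod 2) (Wt t) := by positivity
    have hZ := Zbound K (J t) (fun i => 1 / D i)
      (fun i hi => (one_div_pos.mpr (hD0 i (hJI t i hi))).le) (Wt t)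
      (fun i hi => hWt t i (hJI t i hi) (Finset.mem_filter.mp hi).2)
      (by
        intro U
        have := hdWt t U
        simp only [hJ, Finset.filter_filter]
        exact this) k (by omega) hV
    calc _ ≤ ∑ x ∈ univ.filter (fun x : V => x ∉ Wt t),
          2 / 2 ^ finrank (ZMod 2) (Wt t) * Real.exp (-(8 * Real.log k * G t x)) := by
          apply Finset.sum_le_sum
          intro x _
          have e1 := hEbound t x (ε / 2) (abs_of_pos (by linarith))
          have e2 := hEbound t x (-(ε / 2)) (by rw [abs_neg]; exact abs_of_pos (by linarith))
          have e3 : ∑ T : Finset ι, wt p T *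
            ((E t x (ε / 2) T + E t x (-(ε / 2)) T) / 2 ^ finrank (ZMod 2) (Wt t)) =
            (∑ T : Finset ι, wt p T * E t x (ε / 2) T + ∑ T : Finset ι, wt p T * E t x (-(ε / 2)) T)
              / 2 ^ finrank (ZMod 2) (Wt t) := by
            rw [← Finset.sum_add_distrib, Finset.sum_div]
            apply Finset.sum_congr rfl
            intro T _
            ring
          rw [e3, div_mul_eq_mul_div]
          gcongr
          linarith
      _ = 2 / 2 ^ finrank (ZMod 2) (Wt t) * ∑ x ∈ univ.filter (fun x : V => x ∉ Wt t),
          Real.exp (-(8 * Real.log k * G t x)) := by rw [Finset.mul_sum]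
      _ ≤ 2 / 2 ^ finrank (ZMod 2) (Wt t) *
          (2 ^ finrank (ZMod 2) (Wt t) * (2 / (k : ℝ) ^ 4)) := by
          apply mul_le_mul_of_nonneg_left hZ (by positivity)
      _ = 4 / (k : ℝ) ^ 4 := by field_simp; norm_num
  have hEF : ∑ T : Finset ι, wt p T * F T < 1 := by
    have h1 : ∑ T : Finset ι, wt p T * F T = ∑ T : Finset ι, wt p T *
      (Real.exp (-(ρ * k)) / 2 * (∏ i : ι, if i ∈ T then (2 : ℝ) else 1)) +
      ∑ t ∈ Θ, ∑ x ∈ univ.filter (fun x : V => x ∉ Wt t), ∑ T : Finset ι, wt p T *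
      ((E t x (ε / 2) T + E t x (-(ε / 2)) T) / 2 ^ finrank (ZMod 2) (Wt t)) := by
      simp only [hF, mul_add, Finset.sum_add_distrib]
      congr 1
      simp only [Finset.mul_sum]
      rw [Finset.sum_comm]
      apply Finset.sum_congr rfl
      intro t _
      rw [Finset.sum_comm]
    rw [h1]
    have h2 := Finset.sum_le_sum hlevel
    rw [Finset.sum_const, nsmul_eq_mul] at h2
    have h3 : (Θ.card : ℝ) * (4 / (k : ℝ) ^ 4) ≤ k * (4 / (k : ℝ) ^ 4) := by
      gcongr
    have h4 : (k : ℝ) * (4 / (k : ℝ) ^ 4) = 4 / (k : ℝ) ^ 3 := by field_simp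
    have h5 : 4 / (k : ℝ) ^ 3 ≤ 4 / 8 ^ 3 := by gcongr
    norm_num at h5
    linarith
  obtain ⟨T, hFT, hT1, hT0⟩ := wt_exists p hp0 hp1 F 1 hEF
  have hEnn : ∀ t x l, 0 ≤ E t x l T := fun t x l => (Real.exp_pos _).le
  have hpart2 : 0 ≤ ∑ t ∈ Θ, ∑ x ∈ univ.filter (fun x : V => x ∉ Wt t),
      (E t x (ε / 2) T + E t x (-(ε / 2)) T) / 2 ^ finrank (ZMod 2) (Wt t) := by
    apply Finset.sum_nonneg
    intro t _
    apply Finset.sum_nonneg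
    intro x _
    exact div_nonneg (add_nonneg (hEnn _ _ _) (hEnn _ _ _)) (by positivity)
  have hprodT : (∏ i : ι, if i ∈ T then (2 : ℝ) else 1) = 2 ^ T.card := by
    rw [Finset.prod_ite_mem, Finset.univ_inter, Finset.prod_const]
  have hpart1 : 0 ≤ Real.exp (-(ρ * k)) / 2 * (∏ i : ι, if i ∈ T then (2 : ℝ) else 1) := by
    rw [hprodT]; positivity
  -- deviation bound
  have hdev0 : ∀ t ∈ Θ, ∀ x ∉ Wt t, E t x (ε / 2) T + E t x (-(ε / 2)) T < 1 := by
    intro t ht x hx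
    have hinv : ∀ y ∈ Wt t, (J t).filter (fun i => x + y ∉ K i) = (J t).filter (fun i => x ∉ K i) := by
      intro y hy
      apply Finset.filter_congr
      intro i hi
      have : y ∈ K i := hWt t i (hJI t i hi) (Finset.mem_filter.mp hi).2 hy
      rw [not_iff_not]
      exact (K i).add_mem_iff_left this
    have hEinv : ∀ y ∈ Wt t, ∀ l, E t (x + y) l T = E t x l T := by
      intro y hy l
      simp only [hE, hA, hG, hinv y hy]
    have h1 : ∑ x ∈ univ.filter (fun x : V => x ∉ Wt t),
      (E t x (ε / 2) T + E t x (-(ε / 2)) T) / 2 ^ finrank (ZMod 2) (Wt t) < 1 := by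
      refine lt_of_le_of_lt ?_ hFT
      simp only [hF]
      refine le_trans ?_ (le_add_of_nonneg_left hpart1)
      exact Finset.single_le_sum (f := fun t => ∑ x ∈ univ.filter (fun x : V => x ∉ Wt t),
        (E t x (ε / 2) T + E t x (-(ε / 2)) T) / 2 ^ finrank (ZMod 2) (Wt t))
        (fun t _ => Finset.sum_nonneg (fun x _ =>
          div_nonneg (add_nonneg (hEnn _ _ _) (hEnn _ _ _)) (by positivity))) ht
    refine lt_of_le_of_lt ?_ h1
    have hcardW : ((univ.filter (fun y : V => y ∈ Wt t)).card : ℝ) =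
        2 ^ finrank (ZMod 2) (Wt t) := by
      have := Module.card_eq_pow_finrank (K := ZMod 2) (V := Wt t)
      rw [ZMod.card, Fintype.card_subtype] at this
      exact_mod_cast this
    have hsub : (univ.filter (fun y : V => y ∈ Wt t)).image (fun y => x + y) ⊆
        univ.filter (fun x : V => x ∉ Wt t) := by
      intro z hz
      rw [Finset.mem_image] at hz
      obtain ⟨y, hy, rfl⟩ := hz
      rw [Finset.mem_filter] at hy ⊢
      refine ⟨Finset.mem_univ _, fun h => hx ?_⟩
      exact ((Wt t).add_mem_iff_left hy.2).mp h
    refine le_trans ?_ (Finset.sum_le_sum_of_subset_of_nonneg hsub (fun x _ _ =>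
          div_nonneg (add_nonneg (hEnn _ _ _) (hEnn _ _ _)) (by positivity)))
    rw [Finset.sum_image (fun a _ b _ h => add_left_cancel h)]
    rw [Finset.sum_congr rfl (g := fun _ => (E t x (ε / 2) T + E t x (-(ε / 2)) T) /
      2 ^ finrank (ZMod 2) (Wt t)) (by
        intro y hy
        rw [Finset.mem_filter] at hy
        rw [hEinv y hy.2, hEinv y hy.2])]
    rw [Finset.sum_const, nsmul_eq_mul, hcardW]
    apply le_of_eq
    field_simp
  have hdev : ∀ t ∈ Θ, ∀ x, |∑ i ∈ A t x, ((if i ∈ T then (1 : ℝ) else 0) - p i)| ≤ ε * ρ * G t x := by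
    intro t ht x
    by_cases hx : x ∈ Wt t
    · have : (J t).filter (fun i => x ∉ K i) = ∅ := by
        rw [Finset.filter_eq_empty_iff]
        intro i hi
        rw [not_not]
        exact hWt t i (hJI t i hi) (Finset.mem_filter.mp hi).2 hx
      simp [hA, hG, this]
    · have h1 := hdev0 t ht x hx
      have h2 := hEnn t x (ε / 2)
      have h3 := hEnn t x (-(ε / 2))
      have h4 : E t x (ε / 2) T < 1 := by linarith
      have h5 : E t x (-(ε / 2)) T < 1 := by linarith
      simp only [hE] at h4 h5
      rw [Real.exp_lt_one_iff] at h4 h5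
      rw [abs_le]
      have hε2 : 0 < ε / 2 := by linarith
      constructor
      · apply le_of_mul_le_mul_left _ hε2
        linarith
      · apply le_of_mul_le_mul_left _ hε2
        linarith
  refine ⟨T, fun i => if i ∈ I then 1 / p i else 0, ?_, ?_, ?_⟩
  · intro i
    dsimp only
    split_ifs
    · exact one_div_nonneg.mpr (hp0 i)
    · exact le_rfl
  · have h1 : Real.exp (-(ρ * k)) / 2 * 2 ^ T.card < 1 := by
      rw [← hprodT]
      refine lt_of_le_of_lt ?_ hFT
      simp only [hF]
      linarith
    have h2 : (2 : ℝ) ^ T.card < 2 * Real.exp (ρ * k) := by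
      rw [Real.exp_neg] at h1
      have := Real.exp_pos (ρ * k)
      field_simp at h1
      linarith
    have h3 := Real.log_lt_log (by positivity) h2
    rw [Real.log_pow, Real.log_mul (by norm_num) (Real.exp_pos _).ne', Real.log_exp] at h3
    have hl2 : 0 < Real.log 2 := Real.log_pos (by norm_num)
    have : 1 + ρ * k / Real.log 2 = (Real.log 2 + ρ * k) / Real.log 2 := by field_simp
    rw [this, le_div_iff₀ hl2]
    exact h3.le
  · intro x
    set B : Finset ι := I.filter (fun i => x ∉ K i) with hB
    have hBu : univ.filter (fun i => x ∉ K i) = B := by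
      ext i
      simp only [hB, hI, Finset.mem_filter, Finset.mem_univ, true_and]
      refine ⟨fun h => ⟨fun h' => h (by rw [h']; trivial), h⟩, fun h => h.2⟩
    have hw : ∑ i ∈ T.filter (fun i => x ∉ K i), (if i ∈ I then 1 / p i else 0) =
        ∑ i ∈ B, (if i ∈ T then (1 : ℝ) else 0) / p i := by
      have e1 : ∀ i ∈ B, (if i ∈ T then (1 : ℝ) else 0) / p i = if i ∈ T then 1 / p i else 0 := by
        intro i _
        split_ifs <;> simp
      rw [Finset.sum_congr rfl e1, ← Finset.sum_filter, ← Finset.sum_filter]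
      apply Finset.sum_congr _ (fun _ _ => rfl)
      ext i
      simp only [hB, Finset.mem_filter]
      tauto
    rw [hBu, hw]
    have hBD : ∀ i ∈ B, i ∈ I := fun i hi => (Finset.mem_filter.mp hi).1
    -- per threshold
    have hthr : ∀ j ∈ B, |∑ i ∈ B.filter (fun i => D j ≤ D i),
        ((if i ∈ T then (1 : ℝ) else 0) / p i / D i - 1 / D i)| ≤
        ε * ∑ i ∈ B.filter (fun i => D j ≤ D i), 1 / D i := by
      intro j hj
      have h1 := hdev (D j) (hDΘ j (hBD j hj)).1 x
      have h2 : B.filter (fun i => D j ≤ D i) = (J (D j)).filter (fun i => x ∉ K i) := by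
        ext i; simp only [hB, hJ, Finset.mem_filter]; tauto
      rw [h2]
      have h3 : ∑ i ∈ (J (D j)).filter (fun i => x ∉ K i),
          ((if i ∈ T then (1 : ℝ) else 0) / p i / D i - 1 / D i) =
          (∑ i ∈ A (D j) x, ((if i ∈ T then (1 : ℝ) else 0) - p i)) / ρ := by
        simp only [hA]
        rw [Finset.sum_filter (s := (J (D j)).filter (fun i => x ∉ K i)), Finset.sum_div]
        apply Finset.sum_congr rfl
        intro i hi
        have hiI := hJI _ i (Finset.mem_filter.mp hi).1
        have hDi := hD0 i hiI
        by_cases hρD : ρ < D i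
        · have hpi : p i = ρ / D i := by
            simp only [hp, hiI, if_true]
            exact min_eq_right ((div_le_one hDi).mpr hρD.le)
          rw [if_pos hρD, hpi]
          field_simp
        · have hpi : p i = 1 := by
            simp only [hp, hiI, if_true]
            exact min_eq_left ((one_le_div hDi).mpr (not_lt.mp hρD))
          rw [if_neg hρD, if_pos (hT1 i hpi), hpi]
          simp
      rw [h3, abs_div, abs_of_pos hρ0, div_le_iff₀ hρ0]
      refine h1.trans (le_of_eq ?_)
      simp only [hG]
      ring
    have hcomb : ∀ σ : ℝ, |σ| = 1 →
        0 ≤ ∑ i ∈ B, (D i - 0) * (ε * (1 / D i) - σ *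
          ((if i ∈ T then (1 : ℝ) else 0) / p i / D i - 1 / D i)) := by
      intro σ hσ
      apply abel D _ B.card B le_rfl 0 (fun i hi => (hD0 i (hBD i hi)).le)
      intro j hj
      rw [Finset.sum_sub_distrib, ← Finset.mul_sum, ← Finset.mul_sum]
      have h1 := hthr j hj
      have h2 := le_abs_self (σ * ∑ i ∈ B.filter (fun i => D j ≤ D i),
        ((if i ∈ T then (1 : ℝ) else 0) / p i / D i - 1 / D i))
      rw [abs_mul, hσ, one_mul] at h2
      linarith
    have hexpand : ∀ σ : ℝ, ∑ i ∈ B, (D i - 0) * (ε * (1 / D i) - σ *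
          ((if i ∈ T then (1 : ℝ) else 0) / p i / D i - 1 / D i)) =
          ε * B.card - σ * (∑ i ∈ B, (if i ∈ T then (1 : ℝ) else 0) / p i - B.card) := by
      intro σ
      have : ∀ i ∈ B, (D i - 0) * (ε * (1 / D i) - σ *
          ((if i ∈ T then (1 : ℝ) else 0) / p i / D i - 1 / D i)) =
          ε - σ * ((if i ∈ T then (1 : ℝ) else 0) / p i - 1) := by
        intro i hi
        have := (hD0 i (hBD i hi)).ne'
        generalize (if i ∈ T then (1 : ℝ) else 0) / p i = z
        field_simp
        ring
      rw [Finset.sum_congr rfl this, Finset.sum_sub_distrib, ← Finset.mul_sum,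
        Finset.sum_sub_distrib]
      simp only [Finset.sum_const, nsmul_eq_mul, mul_one]
      ring
    have c1 := hcomb 1 (by simp)
    have c2 := hcomb (-1) (by simp)
    rw [hexpand] at c1 c2
    constructor <;> linarith

/-- Vectors constant on a hyperedge. -/
def cst {k : ℕ} (e : Finset (Fin k)) : Submodule (ZMod 2) (Fin k → ZMod 2) where
  carrier := {x | ∀ u ∈ e, ∀ v ∈ e, x u = x v}
  add_mem' := by
    intro a b ha hb u hu v hv
    simp only [Pi.add_apply]
    rw [ha u hu v hv, hb u hu v hv]
  zero_mem' := by intro u _ v _; rfl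
  smul_mem' := by
    intro c a ha u hu v hv
    simp only [Pi.smul_apply]
    rw [ha u hu v hv]

theorem cross_iff {k : ℕ} (e S : Finset (Fin k)) :
    ((e ∩ S).Nonempty ∧ ¬ e ⊆ S) ↔ (fun v => if v ∈ S then (1 : ZMod 2) else 0) ∉ cst e := by
  constructor
  · rintro ⟨⟨u, hu⟩, h⟩ hc
    rw [Finset.not_subset] at h
    obtain ⟨v, hv, hvS⟩ := h
    rw [Finset.mem_inter] at hu
    have := hc u hu.1 v hv
    simp [hu.2, hvS] at this
  · intro h
    by_contra hcon
    apply h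
    intro u hu v hv
    by_cases hne : (e ∩ S).Nonempty
    · have hs : e ⊆ S := by
        by_contra h'
        exact hcon ⟨hne, h'⟩
      simp [hs hu, hs hv]
    · rw [Finset.not_nonempty_iff_eq_empty] at hne
      have : ∀ z ∈ e, z ∉ S := by
        intro z hz hzS
        have : z ∈ e ∩ S := Finset.mem_inter.mpr ⟨hz, hzS⟩
        rw [hne] at this
        simp at this
      simp [this u hu, this v hv]

/-- Merging identical hyperedges. -/
theorem trivial_sparsifier {k m : ℕ} (e : Fin m → Finset (Fin k)) :
    ∃ (T : Finset (Fin m)) (w : Fin m → ℝ), (∀ i, 0 ≤ w i) ∧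
      T.card ≤ (univ.filter (fun s : Finset (Fin k) => 2 ≤ s.card)).card ∧
      ∀ S : Finset (Fin k),
        ∑ i ∈ T.filter (fun i => (e i ∩ S).Nonempty ∧ ¬ e i ⊆ S), w i =
        ((univ.filter (fun i => (e i ∩ S).Nonempty ∧ ¬ e i ⊆ S)).card : ℝ) := by
  classical
  rcases isEmpty_or_nonempty (Fin m) with hm | hm
  · exact ⟨∅, fun _ => 0, fun _ => le_rfl, by simp, by simp⟩
  set Q := (univ.filter (fun i => 2 ≤ (e i).card)).image e with hQ
  have hrep : ∀ s ∈ Q, ∃ i, e i = s := by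
    intro s hs
    rw [hQ, Finset.mem_image] at hs
    obtain ⟨i, _, h⟩ := hs
    exact ⟨i, h⟩
  choose! f hf using hrep
  have hinj : Set.InjOn f (Q : Set (Finset (Fin k))) := by
    intro a ha b hb hab
    rw [← hf a ha, ← hf b hb, hab]
  refine ⟨Q.image f, fun i => ((univ.filter (fun j => e j = e i)).card : ℝ),
    fun i => by positivity, ?_, ?_⟩
  · refine Finset.card_image_le.trans (Finset.card_le_card ?_)
    intro s hs
    rw [hQ, Finset.mem_image] at hs
    obtain ⟨i, hi, rfl⟩ := hs
    rw [Finset.mem_filter] at hi ⊢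
    exact ⟨Finset.mem_univ _, hi.2⟩
  · intro S
    rw [Finset.sum_filter, Finset.sum_image hinj]
    have h1 : ∀ s ∈ Q, (if (e (f s) ∩ S).Nonempty ∧ ¬ e (f s) ⊆ S then
        ((univ.filter (fun j => e j = e (f s))).card : ℝ) else 0) =
        (((univ.filter (fun i => (e i ∩ S).Nonempty ∧ ¬ e i ⊆ S)).filter
          (fun j => e j = s)).card : ℝ) := by
      intro s hs
      rw [hf s hs]
      split_ifs with h
      · congr 2
        ext j
        simp only [Finset.mem_filter, Finset.mem_univ, true_and]
        constructor
        · rintro rfl; exact ⟨h, rfl⟩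
        · tauto
      · symm
        rw [Nat.cast_eq_zero, Finset.card_eq_zero, Finset.filter_eq_empty_iff]
        intro j hj hjs
        rw [Finset.mem_filter, hjs] at hj
        exact h hj.2
    rw [Finset.sum_congr rfl h1]
    rw [Finset.card_eq_sum_card_fiberwise (f := e) (t := Q)]
    · push_cast; rfl
    · intro i hi
      rw [Finset.mem_coe, Finset.mem_filter] at hi
      rw [Finset.mem_coe, hQ]
      apply Finset.mem_image_of_mem
      rw [Finset.mem_filter]
      refine ⟨Finset.mem_univ _, ?_⟩
      obtain ⟨_, ⟨u, hu⟩, h⟩ := hi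
      rw [Finset.not_subset] at h
      obtain ⟨v, hv, hvS⟩ := h
      rw [Finset.mem_inter] at hu
      have : 1 < (e i).card := Finset.one_lt_card.mpr ⟨u, hu.1, v, hv, fun h => hvS (h ▸ hu.2)⟩
      omega

theorem small_bound (k : ℕ) (hk : 2 ≤ k) (hk8 : k < 8) (ε : ℝ) (h0 : 0 < ε) (h1 : ε < 1) :
    ((univ.filter (fun s : Finset (Fin k) => 2 ≤ s.card)).card : ℝ) ≤
      5 * k * (Real.log ((k : ℝ) / ε)) ^ (5 : ℕ) / ε ^ 2 := by
  have hk' : (2 : ℝ) ≤ k := by exact_mod_cast hk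
  have hL : Real.log k ≤ Real.log ((k : ℝ) / ε) := by
    apply Real.log_le_log (by linarith)
    rw [le_div_iff₀ h0]
    nlinarith
  have hlk : 0 < Real.log k := Real.log_pos (by linarith)
  have hl2 := Real.log_two_gt_d9
  have key : ∀ c : ℝ, 0 ≤ c → c ≤ Real.log k →
      5 * (k : ℝ) * c ^ 5 ≤ 5 * k * (Real.log ((k : ℝ) / ε)) ^ (5 : ℕ) / ε ^ 2 := by
    intro c hc hck
    have hε2 : ε ^ 2 ≤ 1 := by nlinarith
    rw [le_div_iff₀ (by positivity)]
    have e1 : 5 * (k : ℝ) * c ^ 5 ≤ 5 * k * (Real.log ((k : ℝ) / ε)) ^ (5 : ℕ) := by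
      gcongr
      exact hck.trans hL
    have e2 : 5 * (k : ℝ) * c ^ 5 * ε ^ 2 ≤ 5 * (k : ℝ) * c ^ 5 * 1 := by gcongr
    linarith
  have hall : (univ.filter (fun s : Finset (Fin k) => 2 ≤ s.card)).card ≤ 2 ^ k := by
    refine (Finset.card_le_univ _).trans ?_
    simp
  have hall' : ((univ.filter (fun s : Finset (Fin k) => 2 ≤ s.card)).card : ℝ) ≤ 2 ^ k := by
    exact_mod_cast hall
  have h4 : 4 ≤ k → (1.38 : ℝ) ≤ Real.log k := by
    intro h
    have : Real.log 4 ≤ Real.log k := Real.log_le_log (by norm_num) (by exact_mod_cast h)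
    have e : Real.log 4 = 2 * Real.log 2 := by
      rw [show (4 : ℝ) = 2 ^ 2 by norm_num, Real.log_pow]; norm_num
    linarith
  interval_cases k
  · have hc : (univ.filter (fun s : Finset (Fin 2) => 2 ≤ s.card)).card = 1 := by decide
    rw [hc]
    refine le_trans ?_ (key 0.69 (by norm_num) (by push_cast; linarith))
    norm_num
  · refine hall'.trans (le_trans ?_ (key 1 (by norm_num) ?_))
    · norm_num
    · rw [Real.le_log_iff_exp_le (by norm_num)]
      have := Real.exp_one_lt_d9
      push_cast
      linarith
  all_goals
    refine hall'.trans (le_trans ?_ (key 1.38 (by norm_num) (h4 (by norm_num))))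
    norm_num

theorem large_bound (k : ℕ) (hk : 8 ≤ k) (ε : ℝ) (h0 : 0 < ε) (h1 : ε < 1) :
    1 + 32 * Real.log k / ε ^ 2 * k / Real.log 2 ≤
      5 * k * (Real.log ((k : ℝ) / ε)) ^ (5 : ℕ) / ε ^ 2 := by
  have hk' : (8 : ℝ) ≤ k := by exact_mod_cast hk
  have hL : Real.log k ≤ Real.log ((k : ℝ) / ε) := by
    apply Real.log_le_log (by linarith)
    rw [le_div_iff₀ h0]
    nlinarith
  have hl2 := Real.log_two_gt_d9
  have hlk : 2 ≤ Real.log k := by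
    have : Real.log 8 ≤ Real.log k := Real.log_le_log (by norm_num) hk'
    have e : Real.log 8 = 3 * Real.log 2 := by
      rw [show (8 : ℝ) = 2 ^ 3 by norm_num, Real.log_pow]; norm_num
    linarith
  set l := Real.log k with hl
  have hε2 : ε ^ 2 ≤ 1 := by nlinarith
  have e1 : 32 * l / ε ^ 2 * k / Real.log 2 ≤ 50 * l * k / ε ^ 2 := by
    rw [show 32 * l / ε ^ 2 * k / Real.log 2 = (32 / Real.log 2) * (l * k / ε ^ 2) by ring,
      show 50 * l * k / ε ^ 2 = 50 * (l * k / ε ^ 2) by ring]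
    have : 32 / Real.log 2 ≤ 50 := by
      rw [div_le_iff₀ (by linarith)]; linarith
    gcongr
  have e2 : 1 ≤ l * k / ε ^ 2 := by
    rw [le_div_iff₀ (by positivity)]
    nlinarith
  have e3 : 5 * k * l ^ (5 : ℕ) / ε ^ 2 ≤
      5 * k * (Real.log ((k : ℝ) / ε)) ^ (5 : ℕ) / ε ^ 2 := by gcongr
  have e4 : 80 * (l * k / ε ^ 2) ≤ 5 * k * l ^ (5 : ℕ) / ε ^ 2 := by
    rw [show 5 * k * l ^ (5 : ℕ) / ε ^ 2 = (5 * l ^ 4) * (l * k / ε ^ 2) by ring]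
    have : (2 : ℝ) ^ 4 ≤ l ^ 4 := by gcongr
    gcongr
    linarith
  have e5 : 50 * l * k / ε ^ 2 = 50 * (l * k / ε ^ 2) := by ring
  linarith

end HCS

/-- Every hypergraph on `k ≥ 2` vertices admits a `(1 ± ε)` cut sparsifier
keeping at most `C · k · (log(k/ε))^C / ε²` weighted hyperedges. -/
theorem hypergraph_cut_sparsification :
    ∃ C : ℝ, 0 < C ∧
      ∀ (k : ℕ), 2 ≤ k →
        ∀ ε : ℝ, ε ∈ Set.Ioo (0 : ℝ) 1 →
          ∀ (m : ℕ) (e : Fin m → Finset (Fin k)),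
            ∃ (T : Finset (Fin m)) (w : Fin m → ℝ),
              (∀ i, 0 ≤ w i) ∧
              (T.card : ℝ) ≤ C * k * (Real.log ((k : ℝ) / ε)) ^ C / ε ^ 2 ∧
              ∀ S : Finset (Fin k),
                (1 - ε) *
                    ((Finset.univ.filter
                      (fun i => (e i ∩ S).Nonempty ∧ ¬ e i ⊆ S)).card : ℝ)
                  ≤ (∑ i ∈ T.filter (fun i => (e i ∩ S).Nonempty ∧ ¬ e i ⊆ S), w i) ∧
                (∑ i ∈ T.filter (fun i => (e i ∩ S).Nonempty ∧ ¬ e i ⊆ S), w i)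
                  ≤ (1 + ε) *
                    ((Finset.univ.filter
                      (fun i => (e i ∩ S).Nonempty ∧ ¬ e i ⊆ S)).card : ℝ) := by
  refine ⟨5, by norm_num, ?_⟩
  intro k hk ε hε m e
  have h5 : ∀ y : ℝ, y ^ (5 : ℝ) = y ^ (5 : ℕ) := fun y => by
    rw [← Real.rpow_natCast]; norm_num
  rw [h5]
  rcases lt_or_ge k 8 with h8 | h8
  · obtain ⟨T, w, hw, hT, hS⟩ := HCS.trivial_sparsifier e
    refine ⟨T, w, hw, ?_, ?_⟩
    · refine le_trans ?_ (HCS.small_bound k hk h8 ε hε.1 hε.2)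
      exact_mod_cast hT
    · intro S
      rw [hS S]
      have hc : (0 : ℝ) ≤ ((Finset.univ.filter
        (fun i => (e i ∩ S).Nonempty ∧ ¬ e i ⊆ S)).card : ℝ) := Nat.cast_nonneg _
      have := mul_nonneg hε.1.le hc
      constructor <;> linarith
  · obtain ⟨T, w, hw, hT, hx⟩ := HCS.core (fun i => HCS.cst (e i)) k h8 (by simp) ε hε.1 hε.2
    refine ⟨T, w, hw, hT.trans (HCS.large_bound k h8 ε hε.1 hε.2), ?_⟩
    intro S
    have := hx (fun v => if v ∈ S then (1 : ZMod 2) else 0)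
    classical
    have hf : ∀ R : Finset (Fin m), R.filter (fun i => (e i ∩ S).Nonempty ∧ ¬ e i ⊆ S) =
        R.filter (fun i => (fun v => if v ∈ S then (1 : ZMod 2) else 0) ∉ HCS.cst (e i)) :=
      fun R => Finset.filter_congr (fun i _ => HCS.cross_iff (e i) S)
    rw [hf, hf]
    convert this
end

section
/- Let k ≥ 1 and d ≥ 1 be integers and let H be a hypergraph on vertex set {1,…,k} with hyperedges e_1,…,e_m ⊆ {1,…,k}. Then there exists a subset R ⊆ {1,…,m} with |R| ≤ k·d such that for every integer α ≥ 1, the number of distinct sets of the form δ(S) = {i ∈ {1,…,m}∖R : e_i crosses S}, taken over all vertex subsets S ⊆ {1,…,k}, that satisfy |δ(S)| ≤ α·d, is at most (2k)^{2α}. -/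
namespace HDecomp

open Classical in
/-- support of a code -/
noncomputable def supp {F ι : Type} [Field F] [Fintype ι] (W : Submodule F (ι → F)) : Finset ι :=
  Finset.univ.filter (fun i => ∃ w ∈ W, w i ≠ 0)

/-- weight of a word -/
noncomputable def wt {F ι : Type} [Field F] [Fintype ι] [DecidableEq F] (c : ι → F) : ℕ :=
  (Finset.univ.filter (fun i => c i ≠ 0)).card

open Classical in
/-- light codewords -/
noncomputable def light {F ι : Type} [Field F] [Fintype F] [Fintype ι]
    (W : Submodule F (ι → F)) (t : ℕ) : Finset (ι → F) :=
  Finset.univ.filter (fun c => c ∈ W ∧ wt c ≤ t)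

lemma light_le {F ι : Type} [Field F] [Fintype F] [Fintype ι]
    (W : Submodule F (ι → F)) (t : ℕ) :
    (light W t).card ≤ Fintype.card F ^ Module.finrank F W := by
  classical
  have h1 : (light W t).card ≤ (Finset.univ.filter (fun c => c ∈ W)).card := by
    apply Finset.card_le_card
    intro c hc
    simp only [light, Finset.mem_filter, Finset.mem_univ, true_and] at hc ⊢
    exact hc.1
  have h2 : Fintype.card W = (Finset.univ.filter (fun c => c ∈ W)).card :=
    Fintype.card_subtype _
  rw [← h2, Module.card_eq_pow_finrank (K := F) (V := W)] at h1
  exact h1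

lemma light_bound {F ι : Type} [Field F] [Fintype F] [Fintype ι] (d α : ℕ) (hd : 1 ≤ d) (j : ℕ) :
    ∀ (D : Submodule F (ι → F)), (∀ W ≤ D, d * Module.finrank F W ≤ (supp W).card) →
      Module.finrank F D = α + j →
      (light D (α * d)).card ≤ Fintype.card F ^ α * (α + j).choose α := by
  classical
  induction j with
  | zero =>
    intro D _ hn
    have := light_le D (α * d)
    rw [hn] at this
    simpa using this
  | succ j ih =>
    intro D hD hn
    set B := Fintype.card F ^ α * (α + j).choose α with hB
    set N := (light D (α * d)).card with hN
    set s := (supp D).card with hs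
    have hsd : d * (α + j + 1) ≤ s := by
      have := hD D le_rfl
      rw [hn] at this; exact this
    -- double counting
    have hcount : N * (s - α * d) ≤ s * B := by
      apply Finset.card_mul_le_card_mul (fun (c : ι → F) (i : ι) => c i = 0)
        (s := light D (α * d)) (t := supp D)
      · intro c hc
        simp only [light, Finset.mem_filter, Finset.mem_univ, true_and] at hc
        have h1 : supp D ⊆ (Finset.bipartiteAbove (fun (c : ι → F) (i : ι) => c i = 0) (supp D) c)
            ∪ Finset.univ.filter (fun i => c i ≠ 0) := by
          intro i hi
          by_cases h : c i = 0 <;> simp [Finset.bipartiteAbove, h, hi]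
        have h2 := (Finset.card_le_card h1).trans (Finset.card_union_le _ _)
        have h3 := hc.2
        unfold wt at h3
        omega
      · intro i hi
        simp only [supp, Finset.mem_filter, Finset.mem_univ, true_and] at hi
        obtain ⟨w, hw, hwi⟩ := hi
        let f : D →ₗ[F] F := (LinearMap.proj i).comp D.subtype
        have hf : Function.Surjective f := by
          intro a
          refine ⟨(a / w i) • ⟨w, hw⟩, ?_⟩
          simp [f, hwi]
        let E : Submodule F (ι → F) := (LinearMap.ker f).map D.subtype
        have hE : E ≤ D := Submodule.map_subtype_le _ _
        have hfr : Module.finrank F E = α + j := by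
          have h1 : Module.finrank F E = Module.finrank F (LinearMap.ker f) :=
            Submodule.finrank_map_subtype_eq _ _
          have h2 := LinearMap.finrank_range_add_finrank_ker f
          rw [LinearMap.range_eq_top.mpr hf, finrank_top, Module.finrank_self] at h2
          omega
        refine le_trans (Finset.card_le_card ?_)
          (ih E (fun W hW => hD W (hW.trans hE)) hfr)
        intro c hc
        simp only [Finset.bipartiteBelow, light, Finset.mem_filter, Finset.mem_univ, true_and]
          at hc ⊢
        refine ⟨?_, hc.1.2⟩
        refine Submodule.mem_map.mpr ⟨⟨c, hc.1.1⟩, ?_, rfl⟩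
        simp [f, hc.2]
    have hspos : 0 < s := by
      have : 0 < d * (α + j + 1) := by positivity
      omega
    obtain ⟨u, hu⟩ : ∃ u, s = α * d + u := by
      refine ⟨s - α * d, ?_⟩
      have : α * d ≤ s := by nlinarith
      omega
    have hu' : s - α * d = u := by omega
    rw [hu'] at hcount
    have hsu : s * (j + 1) ≤ (α + j + 1) * u := by
      have h5 : d * (j + 1) ≤ u := by nlinarith
      rw [hu]; nlinarith
    have hkey : N * (j + 1) ≤ (α + j + 1) * B := by
      apply Nat.le_of_mul_le_mul_left _ hspos
      calc s * (N * (j + 1)) = N * (s * (j + 1)) := by ring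
        _ ≤ N * ((α + j + 1) * u) := Nat.mul_le_mul_left _ hsu
        _ = (α + j + 1) * (N * u) := by ring
        _ ≤ (α + j + 1) * (s * B) := Nat.mul_le_mul_left _ hcount
        _ = s * ((α + j + 1) * B) := by ring
    have hch := Nat.choose_mul_succ_eq (α + j) α
    have h6 : α + j + 1 - α = j + 1 := by omega
    rw [h6] at hch
    apply Nat.le_of_mul_le_mul_right _ (Nat.succ_pos j)
    calc N * (j + 1) ≤ (α + j + 1) * B := hkey
      _ = Fintype.card F ^ α * ((α + j).choose α * (α + j + 1)) := by rw [hB]; ring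
      _ = Fintype.card F ^ α * ((α + j + 1).choose α * (j + 1)) := by rw [hch]
      _ = Fintype.card F ^ α * (α + (j + 1)).choose α * (j + 1) := by rw [← add_assoc]; ring

lemma light_bound' {F ι : Type} [Field F] [Fintype F] [Fintype ι] (d α k : ℕ) (hd : 1 ≤ d)
    (hk : 1 ≤ k)
    (D : Submodule F (ι → F)) (hD : ∀ W ≤ D, d * Module.finrank F W ≤ (supp W).card)
    (hn : Module.finrank F D ≤ k) :
    (light D (α * d)).card ≤ Fintype.card F ^ α * k ^ α := by
  rcases le_total (Module.finrank F D) α with h | h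
  · calc (light D (α * d)).card ≤ Fintype.card F ^ Module.finrank F D := light_le _ _
      _ ≤ Fintype.card F ^ α := Nat.pow_le_pow_right Fintype.card_pos h
      _ ≤ _ := Nat.le_mul_of_pos_right _ (by positivity)
  · obtain ⟨j, hj⟩ := Nat.exists_eq_add_of_le h
    refine (light_bound d α hd j D hD hj).trans (Nat.mul_le_mul_left _ ?_)
    exact (Nat.choose_le_pow _ _).trans (Nat.pow_le_pow_left (hj ▸ hn) _)

/-- zero out the coordinates in `R` -/
noncomputable def zeroOut (F : Type) {ι : Type} [Field F] [DecidableEq ι] (R : Finset ι) :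
    (ι → F) →ₗ[F] (ι → F) where
  toFun c i := if i ∈ R then 0 else c i
  map_add' x y := by ext i; by_cases h : i ∈ R <;> simp [h]
  map_smul' a x := by ext i; by_cases h : i ∈ R <;> simp [h]

lemma exists_R {F ι : Type} [Field F] [Fintype F] [Fintype ι] [DecidableEq ι] (d : ℕ)
    (C : Submodule F (ι → F)) :
    ∃ R : Finset ι, R.card ≤ d * Module.finrank F C ∧
      ∀ W ≤ C.map (zeroOut F R), d * Module.finrank F W ≤ (supp W).card := by
  classical
  obtain ⟨V, hV, hmax⟩ := Set.exists_max_image {V : Submodule F (ι → F) | V ≤ C}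
    (fun V => ((d * Module.finrank F V : ℕ) : ℤ) - (supp V).card) (Set.toFinite _) ⟨⊥, show ⊥ ≤ C from bot_le⟩
  have hV' : V ≤ C := hV
  refine ⟨supp V, ?_, ?_⟩
  · have h0 := hmax ⊥ (show ⊥ ≤ C from bot_le)
    have h1 : (supp (⊥ : Submodule F (ι → F))).card = 0 := by simp [supp]
    simp only [h1, finrank_bot, mul_zero] at h0
    have h2 : d * Module.finrank F V ≤ d * Module.finrank F C :=
      Nat.mul_le_mul_left _ (Submodule.finrank_mono hV')
    omega
  · intro W hW
    set π := zeroOut F (supp V) with hπ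
    let U : Submodule F (ι → F) := C ⊓ W.comap π
    have hmap : W ≤ U.map π := by
      intro w hw
      obtain ⟨c, hc, rfl⟩ := Submodule.mem_map.mp (hW hw)
      exact Submodule.mem_map_of_mem ⟨hc, hw⟩
    have hVker : ∀ v ∈ V, π v = 0 := by
      intro v hv
      ext i
      by_cases h : i ∈ supp V
      · simp [hπ, zeroOut, h]
      · have : v i = 0 := by
          by_contra hne
          exact h (by simp only [supp, Finset.mem_filter, Finset.mem_univ, true_and]
                      exact ⟨v, hv, hne⟩)
        simp [hπ, zeroOut, this]
    have hVU : V ≤ U := by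
      intro v hv
      refine ⟨hV' hv, ?_⟩
      simp [hVker v hv]
    have hdim : Module.finrank F W + Module.finrank F V ≤ Module.finrank F U := by
      let g : U →ₗ[F] (ι → F) := π.comp U.subtype
      have h1 := LinearMap.finrank_range_add_finrank_ker g
      have h2 : Module.finrank F W ≤ Module.finrank F (LinearMap.range g) := by
        apply Submodule.finrank_mono
        intro w hw
        obtain ⟨u, hu, rfl⟩ := Submodule.mem_map.mp (hmap hw)
        exact ⟨⟨u, hu⟩, rfl⟩
      have h3 : Module.finrank F V ≤ Module.finrank F (LinearMap.ker g) := by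
        rw [← Submodule.finrank_map_subtype_eq U (LinearMap.ker g)]
        apply Submodule.finrank_mono
        intro v hv
        exact Submodule.mem_map.mpr ⟨⟨v, hVU hv⟩, by simp [g, hVker v hv], rfl⟩
      omega
    have hsupp : (supp U).card ≤ (supp V).card + (supp W).card := by
      refine (Finset.card_le_card ?_).trans (Finset.card_union_le _ _)
      intro i hi
      by_cases h : i ∈ supp V
      · exact Finset.mem_union_left _ h
      · apply Finset.mem_union_right
        simp only [supp, Finset.mem_filter, Finset.mem_univ, true_and] at hi ⊢
        obtain ⟨u, hu, hui⟩ := hi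
        refine ⟨π u, hu.2, ?_⟩
        simpa [hπ, zeroOut, h] using hui
    have hm := hmax U (show U ≤ C from inf_le_left)
    have h4 := Nat.mul_le_mul_left d hdim
    rw [mul_add] at h4
    omega

/-- functional detecting that an edge crosses -/
noncomputable def edgeFun (p k : ℕ) (s : Finset (Fin k)) (v : Fin k) :
    (Fin k → ZMod p) →ₗ[ZMod p] ZMod p :=
  ∑ u ∈ s, ((LinearMap.proj u : (Fin k → ZMod p) →ₗ[ZMod p] ZMod p) - LinearMap.proj v)

lemma exists_fun (p k : ℕ) (hp : k < p) (s : Finset (Fin k)) :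
    ∃ f : (Fin k → ZMod p) →ₗ[ZMod p] ZMod p, ∀ S : Finset (Fin k),
      f (fun u => if u ∈ S then 1 else 0) ≠ 0 ↔ ((s ∩ S).Nonempty ∧ ¬ s ⊆ S) := by
  classical
  have key : ∀ T : Finset (Fin k), ((T.card : ℕ) : ZMod p) = 0 ↔ T = ∅ := by
    intro T
    have hT : T.card < p := lt_of_le_of_lt (by simpa using Finset.card_le_univ T) hp
    rw [ZMod.natCast_eq_zero_iff]
    constructor
    · intro h
      exact Finset.card_eq_zero.mp (Nat.eq_zero_of_dvd_of_lt h hT)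
    · rintro rfl; simp
  rcases s.eq_empty_or_nonempty with rfl | ⟨v, hv⟩
  · exact ⟨0, fun S => by simp⟩
  · refine ⟨edgeFun p k s v, fun S => ?_⟩
    by_cases hvS : v ∈ S
    · have h1 : edgeFun p k s v (fun u => if u ∈ S then 1 else 0)
          = -(((s \ S).card : ℕ) : ZMod p) := by
        rw [Finset.card_eq_sum_ones, Finset.sdiff_eq_filter, Finset.sum_filter]
        simp only [edgeFun, LinearMap.sum_apply, LinearMap.sub_apply, LinearMap.proj_apply, hvS,
          if_true]
        push_cast
        rw [← Finset.sum_neg_distrib]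
        refine Finset.sum_congr rfl fun u _ => ?_
        by_cases h : u ∈ S <;> simp [h]
      rw [h1, neg_ne_zero, Ne, key, Finset.sdiff_eq_empty_iff_subset]
      exact ⟨fun h => ⟨⟨v, Finset.mem_inter.mpr ⟨hv, hvS⟩⟩, h⟩, fun h => h.2⟩
    · have h1 : edgeFun p k s v (fun u => if u ∈ S then 1 else 0)
          = (((s ∩ S).card : ℕ) : ZMod p) := by
        rw [Finset.card_eq_sum_ones, ← Finset.filter_mem_eq_inter, Finset.sum_filter]
        simp only [edgeFun, LinearMap.sum_apply, LinearMap.sub_apply, LinearMap.proj_apply, hvS,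
          if_false]
        push_cast
        refine Finset.sum_congr rfl fun u _ => ?_
        by_cases h : u ∈ S <;> simp [h]
      rw [h1, Ne, key, ← Ne, ← Finset.nonempty_iff_ne_empty]
      exact ⟨fun h => ⟨h, fun hs => hvS (hs hv)⟩, fun h => h.1⟩

end HDecomp

/-- For every hypergraph on `k` vertices and every `d ≥ 1`, one can remove
at most `k·d` hyperedges so that for every `α ≥ 1` the remaining hypergraph has at most
`(2k)^{2α}` distinct cuts of size at most `α·d`. -/
theorem hypergraph_decomposition
    (k d m : ℕ) (hk : 1 ≤ k) (hd : 1 ≤ d) (e : Fin m → Finset (Fin k)) :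
    ∃ R : Finset (Fin m), R.card ≤ k * d ∧
      ∀ α : ℕ, 1 ≤ α →
        {D : Finset (Fin m) |
            (∃ S : Finset (Fin k),
              D = (Finset.univ \ R).filter
                (fun i => (e i ∩ S).Nonempty ∧ ¬ e i ⊆ S)) ∧
            D.card ≤ α * d}.ncard
          ≤ (2 * k) ^ (2 * α) := by
  classical
  obtain ⟨p, hp, hkp, hp2⟩ := Nat.exists_prime_lt_and_le_two_mul k (by omega)
  have : Fact p.Prime := ⟨hp⟩
  choose f hf using fun i => HDecomp.exists_fun p k hkp (e i)
  let Φ : (Fin k → ZMod p) →ₗ[ZMod p] (Fin m → ZMod p) := LinearMap.pi f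
  have hC : Module.finrank (ZMod p) (LinearMap.range Φ) ≤ k := by
    have := LinearMap.finrank_range_le Φ
    simpa using this
  obtain ⟨R, hR, hW⟩ := HDecomp.exists_R d (LinearMap.range Φ)
  refine ⟨R, hR.trans (by rw [mul_comm]; exact Nat.mul_le_mul_right _ hC), fun α _ => ?_⟩
  have hbound := HDecomp.light_bound' d α k hd hk _ hW
    ((Submodule.finrank_map_le _ _).trans hC)
  have hsub : {D : Finset (Fin m) |
            (∃ S : Finset (Fin k),
              D = (Finset.univ \ R).filter
                (fun i => (e i ∩ S).Nonempty ∧ ¬ e i ⊆ S)) ∧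
            D.card ≤ α * d} ⊆
      (((HDecomp.light ((LinearMap.range Φ).map (HDecomp.zeroOut (ZMod p) R)) (α * d)).image
        (fun c => Finset.univ.filter (fun i => c i ≠ 0)) : Finset (Finset (Fin m))) :
          Set (Finset (Fin m))) := by
    rintro D ⟨⟨S, hS⟩, hDc⟩
    have hD : Finset.univ.filter (fun i => HDecomp.zeroOut (ZMod p) R
        (Φ (fun u => if u ∈ S then 1 else 0)) i ≠ 0) = D := by
      rw [hS]
      ext i
      have := hf i S
      by_cases h : i ∈ R
      · simp [HDecomp.zeroOut, h]
      · simp only [Finset.mem_filter, Finset.mem_univ, true_and, Finset.mem_sdiff, h,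
          not_false_eq_true, ← this]
        simp [HDecomp.zeroOut, h, Φ]
    rw [Finset.mem_coe, Finset.mem_image]
    refine ⟨_, ?_, hD⟩
    simp only [HDecomp.light, Finset.mem_filter, Finset.mem_univ, true_and]
    refine ⟨Submodule.mem_map_of_mem ⟨_, rfl⟩, ?_⟩
    rw [← hD] at hDc
    unfold HDecomp.wt
    convert hDc
  calc _ ≤ _ := Set.ncard_le_ncard hsub (Finset.finite_toSet _)
    _ ≤ _ := by rw [Set.ncard_coe_finset]; exact Finset.card_image_le
    _ ≤ Fintype.card (ZMod p) ^ α * k ^ α := hbound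
    _ ≤ (2 * k) ^ α * (2 * k) ^ α := by
      rw [ZMod.card]
      exact Nat.mul_le_mul (Nat.pow_le_pow_left hp2 _) (Nat.pow_le_pow_left (by omega) _)
    _ = (2 * k) ^ (2 * α) := by rw [two_mul α, pow_add]
end

section
/- Let k ≥ 1, let q be a prime with q ≥ k, and let H be a hypergraph on vertex set {1,…,k} with nonempty hyperedges e_1,…,e_m ⊆ {1,…,k}. For each i choose a distinguished vertex v_i ∈ e_i, and define the matrix G ∈ (Z/qZ)^{m×k} by: G_{i,u} = 1 if u ∈ e_i∖{v_i}, G_{i,v_i} = 1 − |e_i| (as an element of Z/qZ, so the entries of row i sum to 0), and G_{i,u} = 0 if u ∉ e_i. Then for every vertex subset S ⊆ {1,…,k}, letting x ∈ (Z/qZ)^k be the 0/1 indicator vector of S, the Hamming weight of Gx equals the number of hyperedges crossing S: wt(Gx) = |{i ∈ {1,…,m} : e_i crosses S}|. -/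
/-- The standard encoding of a hypergraph on `k` vertices as a linear code
over `Z/qZ` (for a prime `q ≥ k`) turns cut sizes into Hamming weights: for every vertex
subset `S` with 0/1 indicator vector `x`, `wt(Gx)` equals the number of hyperedges
crossing `S`. -/
theorem hypergraph_code_encoding
    (k q m : ℕ) (hk : 1 ≤ k) (hq : q.Prime) (hqk : k ≤ q)
    (e : Fin m → Finset (Fin k)) (he : ∀ i, (e i).Nonempty)
    (v : Fin m → Fin k) (hv : ∀ i, v i ∈ e i) :
    ∀ S : Finset (Fin k),
      hammingNorm
        (Matrix.mulVec
          (Matrix.of fun i u =>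
            if u = v i then (1 : ZMod q) - ((e i).card : ZMod q)
            else if u ∈ e i then 1 else 0)
          (fun u => if u ∈ S then (1 : ZMod q) else 0))
      = (Finset.univ.filter (fun i => (e i ∩ S).Nonempty ∧ ¬ e i ⊆ S)).card := by
  intro S
  have key : ∀ T : Finset (Fin k), ∀ w, w ∉ T → ((T.card : ZMod q) = 0 ↔ T = ∅) := by
    intro T w hw
    have hlt : T.card < q := by
      have h1 : T.card < (Finset.univ : Finset (Fin k)).card :=
        Finset.card_lt_card (Finset.ssubset_univ_iff.mpr (fun h => hw (h ▸ Finset.mem_univ w)))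
      simp at h1
      omega
    rw [ZMod.natCast_eq_zero_iff, ← Finset.card_eq_zero]
    constructor
    · intro h
      exact Nat.eq_zero_of_dvd_of_lt h hlt
    · intro h
      simp [h]
  unfold hammingNorm
  congr 1
  apply Finset.filter_congr
  intro i _
  have hrow : Matrix.mulVec
          (Matrix.of fun i u =>
            if u = v i then (1 : ZMod q) - ((e i).card : ZMod q)
            else if u ∈ e i then 1 else 0)
          (fun u => if u ∈ S then (1 : ZMod q) else 0) i
      = ((e i ∩ S).card : ZMod q) - (if v i ∈ S then ((e i).card : ZMod q) else 0) := by
    have h1 : ∀ u, (if u = v i then (1 : ZMod q) - ((e i).card : ZMod q)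
            else if u ∈ e i then 1 else 0) * (if u ∈ S then (1 : ZMod q) else 0)
        = (if u ∈ e i ∩ S then 1 else 0)
          - (if u = v i then (if v i ∈ S then ((e i).card : ZMod q) else 0) else 0) := by
      intro u
      by_cases hu : u = v i
      · subst hu
        by_cases hS : v i ∈ S <;> simp [hS, hv i]
      · by_cases hS : u ∈ S <;> simp [hS, hu]
    simp only [Matrix.mulVec, dotProduct, Matrix.of_apply, h1, Finset.sum_sub_distrib]
    simp
    congr 2
    ext x
    simp
  rw [hrow]
  by_cases hS : v i ∈ S
  · have hc : ((e i).card : ZMod q) = ((e i ∩ S).card : ZMod q) + ((e i \ S).card : ZMod q) := by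
      rw [← Finset.card_inter_add_card_sdiff (e i) S]
      push_cast
      rfl
    have hne : (e i ∩ S).Nonempty := ⟨v i, Finset.mem_inter.mpr ⟨hv i, hS⟩⟩
    have hk2 := key (e i \ S) (v i) (by simp [hS])
    rw [if_pos hS, hc, sub_add_cancel_left, Ne, neg_eq_zero, hk2, Finset.sdiff_eq_empty_iff_subset]
    simp [hne]
  · have hns : ¬ e i ⊆ S := fun h => hS (h (hv i))
    have hk2 := key (e i ∩ S) (v i) (by simp [hS])
    rw [if_neg hS, sub_zero, Ne, hk2, ← Ne, ← Finset.nonempty_iff_ne_empty]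
    simp [hns]
end

section
/- Let G be a simple graph on n ≥ 1 vertices and let c be an integer with 1 ≤ c ≤ n−1. Then there exists a set F of at most (n−1)·c edges of G such that in the graph G − F obtained by deleting the edges of F, every cut is either empty or has size greater than c; that is, for every vertex subset S, the set of edges of G − F with exactly one endpoint in S is either empty or has cardinality greater than c. -/
open Classical in
/-- Deleting a nonempty cut strictly increases the number of connected components. -/
lemma card_components_lt {n : ℕ} (H H' : SimpleGraph (Fin n)) (hle : H' ≤ H)
    (S : Finset (Fin n)) (hS : ∀ u v, H'.Adj u v → (u ∈ S ↔ v ∈ S))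
    (u v : Fin n) (huv : H.Adj u v) (hu : u ∈ S) (hv : v ∉ S) :
    Nat.card H.ConnectedComponent < Nat.card H'.ConnectedComponent := by
  have hreach : ∀ a b, H'.Reachable a b → (a ∈ S ↔ b ∈ S) := by
    rintro a b ⟨w⟩
    induction w with
    | nil => rfl
    | cons h _ ih => exact (hS _ _ h).trans ih
  rw [Nat.card_eq_fintype_card, Nat.card_eq_fintype_card]
  apply Fintype.card_lt_of_surjective_not_injective
    (SimpleGraph.ConnectedComponent.map (SimpleGraph.Hom.ofLE hle))
  · intro x
    induction x using SimpleGraph.ConnectedComponent.ind with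
    | _ a => exact ⟨H'.connectedComponentMk a, rfl⟩
  · intro hinj
    have h1 : H'.connectedComponentMk u = H'.connectedComponentMk v := by
      apply hinj
      exact SimpleGraph.ConnectedComponent.sound huv.reachable
    exact hv ((hreach u v (SimpleGraph.ConnectedComponent.exact h1)).1 hu)

open Classical in
/-- From any simple graph on `n` vertices one can delete at most
`(n−1)·c` edges so that in the remaining graph every cut is either empty or has size
greater than `c`. -/
theorem remove_small_cuts
    (n : ℕ) (hn : 1 ≤ n) (G : SimpleGraph (Fin n)) [DecidableRel G.Adj]
    (c : ℕ) (hc1 : 1 ≤ c) (hc2 : c ≤ n - 1) :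
    ∃ F : Finset (Sym2 (Fin n)), F ⊆ G.edgeFinset ∧ F.card ≤ (n - 1) * c ∧
      ∀ S : Finset (Fin n),
        ((G.edgeFinset \ F).filter
            (fun ed => (∃ x ∈ ed, x ∈ S) ∧ ¬ (∀ x ∈ ed, x ∈ S))).card = 0 ∨
        c < ((G.edgeFinset \ F).filter
            (fun ed => (∃ x ∈ ed, x ∈ S) ∧ ¬ (∀ x ∈ ed, x ∈ S))).card := by
  let gr : Finset (Sym2 (Fin n)) → SimpleGraph (Fin n) := fun F =>
    SimpleGraph.fromEdgeSet (↑(G.edgeFinset \ F) : Set (Sym2 (Fin n)))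
  let k : Finset (Sym2 (Fin n)) → ℕ := fun F => Nat.card (gr F).ConnectedComponent
  have hk : ∀ F, k F ≤ n := by
    intro F
    have := Nat.card_le_card_of_surjective (gr F).connectedComponentMk
      (fun x => by
        induction x using SimpleGraph.ConnectedComponent.ind with
        | _ a => exact ⟨a, rfl⟩)
    rwa [Nat.card_fin] at this
  obtain ⟨F, hF, hmax⟩ := Finset.exists_max_image
    (G.edgeFinset.powerset.filter (fun F => F.card ≤ (k F - 1) * c)) Finset.card
    ⟨∅, by simp⟩
  simp only [Finset.mem_filter, Finset.mem_powerset] at hF hmax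
  refine ⟨F, hF.1, hF.2.trans (Nat.mul_le_mul_right c (Nat.sub_le_sub_right (hk F) 1)), ?_⟩
  intro S
  by_contra hcon
  rw [not_or, not_lt] at hcon
  obtain ⟨h0, hc⟩ := hcon
  set C := (G.edgeFinset \ F).filter
            (fun ed => (∃ x ∈ ed, x ∈ S) ∧ ¬ (∀ x ∈ ed, x ∈ S)) with hC
  have hCsub : C ⊆ G.edgeFinset \ F := Finset.filter_subset _ _
  have hdisj : Disjoint F C :=
    (Finset.disjoint_sdiff (s := F) (t := G.edgeFinset)).mono_right hCsub
  have hcard : (F ∪ C).card = F.card + C.card := Finset.card_union_of_disjoint hdisj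
  have hle : gr (F ∪ C) ≤ gr F := by
    apply SimpleGraph.fromEdgeSet_mono
    exact_mod_cast Finset.sdiff_subset_sdiff (Finset.Subset.refl _) Finset.subset_union_left
  have hS : ∀ u v, (gr (F ∪ C)).Adj u v → (u ∈ S ↔ v ∈ S) := by
    intro u v h
    have h1 := ((SimpleGraph.fromEdgeSet_adj _).1 h).1
    rw [Finset.mem_coe, Finset.mem_sdiff, Finset.mem_union, not_or] at h1
    obtain ⟨hG, hnF, hnC⟩ := h1
    rw [hC, Finset.mem_filter, Finset.mem_sdiff] at hnC
    simp only [Sym2.mem_iff] at hnC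
    by_contra hne
    apply hnC
    refine ⟨⟨hG, hnF⟩, ?_⟩
    simp only [exists_eq_or_imp, exists_eq_left, forall_eq_or_imp, forall_eq]
    tauto
  obtain ⟨e, he⟩ := Finset.card_pos.1 (Nat.pos_of_ne_zero h0)
  have hex : ∃ u v, (gr F).Adj u v ∧ u ∈ S ∧ v ∉ S := by
    rw [hC, Finset.mem_filter] at he
    obtain ⟨heG, ⟨x, hx, hxS⟩, hy⟩ := he
    push Not at hy
    obtain ⟨y, hy, hyS⟩ := hy
    have hxy : x ≠ y := fun h => hyS (h ▸ hxS)
    have : e = s(x, y) := (Sym2.mem_and_mem_iff hxy).1 ⟨hx, hy⟩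
    subst this
    exact ⟨x, y, (SimpleGraph.fromEdgeSet_adj _).2 ⟨Finset.mem_coe.2 heG, hxy⟩, hxS, hyS⟩
  obtain ⟨u, v, huv, hu, hv⟩ := hex
  have hlt : k F < k (F ∪ C) := card_components_lt _ _ hle S hS u v huv hu hv
  have hpos : 0 < k F :=
    Nat.card_pos_iff.2 ⟨⟨(gr F).connectedComponentMk u⟩, inferInstance⟩
  clear_value k
  have := hmax (F ∪ C) ⟨Finset.union_subset hF.1 (hCsub.trans Finset.sdiff_subset), by
    rw [hcard]
    calc F.card + C.card ≤ (k F - 1) * c + c := Nat.add_le_add hF.2 hc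
      _ = (k F - 1 + 1) * c := by ring
      _ ≤ (k (F ∪ C) - 1) * c := Nat.mul_le_mul_right c (by omega)⟩
  omega
end
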